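/- There exists an absolute constant C > 0 such that the following holds. Let d ≥ 3, let v_1, …, v_d be distinct unit vectors in ℝ^d, b_1, …, b_d ∈ ℝ, and A = {x ∈ ℝ^d : x·v_j ≤ b_j for j = 1,…,d}. Suppose the angle between v_j and v_k is at least α > 0 for all j ≠ k, and the angle between v_l and the two-dimensional subspace spanned by {v_j, v_k} is at least β > 0 for every triple of distinct indices j, k, l with v_k ≠ −v_j. Then for every d×d×d real tensor T, |∫_A ⟨T, ∇³φ_d(z)⟩ dz| ≤ (C (log d)^{3/2}/(αβ)) · max { |⟨T, u_1 ⊗ u_2 ⊗ u_3⟩| : u_1 ∈ V_1, u_2 ∈ V_1 ∪ V_2, u_3 ∈ V_1 ∪ V_2 ∪ V_3 }. -/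

import Mathlib

open MeasureTheory Matrix Real

/-- the standard Gaussian density on `ℝ^d` -/
noncomputable def gaussPDF (d : ℕ) (z : Fin d → ℝ) : ℝ :=
  (2 * π) ^ (-(d : ℝ) / 2) * Real.exp (-(∑ i, z i ^ 2) / 2)

/-- the third partial derivative `∂_a ∂_c ∂_e φ_d(z)` -/
noncomputable def gaussPDF3 (d : ℕ) (a c e : Fin d) (z : Fin d → ℝ) : ℝ :=
  fderiv ℝ (fun w₁ =>
    fderiv ℝ (fun w₂ => fderiv ℝ (gaussPDF d) w₂ (Pi.single e 1)) w₁ (Pi.single c 1))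
    z (Pi.single a 1)

/-- For unit vectors `v ≠ ±w`, the unique unit vector in `span{v, w}` orthogonal to `v`
and with positive inner product with `w`. -/
noncomputable def perpUnit {d : ℕ} (v w : Fin d → ℝ) : Fin d → ℝ :=
  (Real.sqrt (∑ i, (w i - (v ⬝ᵥ w) * v i) ^ 2))⁻¹ • fun i => w i - (v ⬝ᵥ w) * v i

/-- For unit vectors `v, w, u` with three-dimensional span (and `w ≠ ±v`), the unique unit
vector in `span{v, w, u}` orthogonal to `v` and `w`, with positive inner product with `u`. -/
noncomputable def perpUnit2 {d : ℕ} (v w u : Fin d → ℝ) : Fin d → ℝ :=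
  (Real.sqrt (∑ i,
      (u i - (v ⬝ᵥ u) * v i - (perpUnit v w ⬝ᵥ u) * perpUnit v w i) ^ 2))⁻¹ •
    fun i => u i - (v ⬝ᵥ u) * v i - (perpUnit v w ⬝ᵥ u) * perpUnit v w i


/-- Smooth approximations of the step function together with their derivative. -/
structure GoodG (g ρ : ℝ → ℝ) : Prop where
  deriv : ∀ t, HasDerivAt g (ρ t) t
  cont : Continuous ρ
  nonneg : ∀ t, 0 ≤ ρ t
  gnonneg : ∀ t, 0 ≤ g t
  gle : ∀ t, g t ≤ 1
  bdd : ∃ B, 0 ≤ B ∧ ∀ t, ρ t ≤ B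
  integrable : Integrable ρ
  int_Iic : ∀ t, ∫ s in Set.Iic t, ρ s = g t
  int_tot : ∫ s, ρ s = 1

/-- smoothed face weights -/
noncomputable def gW {d : ℕ} (v : Fin d → (Fin d → ℝ)) (b : Fin d → ℝ) (g ρ : ℝ → ℝ)
    (S : Finset (Fin d)) (x : Fin d → ℝ) : ℝ :=
  (∏ j ∈ S, ρ (b j - x ⬝ᵥ v j)) * ∏ l ∈ Sᶜ, g (b l - x ⬝ᵥ v l)

/-- Hermite polynomials -/
noncomputable def H1 {d : ℕ} (u x : Fin d → ℝ) : ℝ := -(x ⬝ᵥ u)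

/-- Hermite polynomials -/
noncomputable def H2 {d : ℕ} (u w x : Fin d → ℝ) : ℝ := (x ⬝ᵥ u) * (x ⬝ᵥ w) - u ⬝ᵥ w

/-- Hermite polynomials -/
noncomputable def H3 {d : ℕ} (q u w x : Fin d → ℝ) : ℝ :=
  -((x ⬝ᵥ q) * (x ⬝ᵥ u) * (x ⬝ᵥ w)) + (q ⬝ᵥ u) * (x ⬝ᵥ w) + (q ⬝ᵥ w) * (x ⬝ᵥ u)
    + (u ⬝ᵥ w) * (x ⬝ᵥ q)

open MeasureTheory Matrix Real

section gauss
variable {d : ℕ}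

lemma dot_line (x q u : Fin d → ℝ) (t : ℝ) : (x + t • q) ⬝ᵥ u = x ⬝ᵥ u + t * (q ⬝ᵥ u) := by
  simp [add_dotProduct, smul_dotProduct]

lemma hasDerivAt_dot_line (x q u : Fin d → ℝ) (t : ℝ) :
    HasDerivAt (fun t : ℝ => (x + t • q) ⬝ᵥ u) (q ⬝ᵥ u) t := by
  simp_rw [dot_line]
  simpa using ((hasDerivAt_id t).mul_const (q ⬝ᵥ u)).const_add (x ⬝ᵥ u)

lemma sum_sq_eq_dot (x : Fin d → ℝ) : ∑ i, x i ^ 2 = x ⬝ᵥ x := by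
  simp [dotProduct, sq]

lemma gaussPDF_eq (x : Fin d → ℝ) :
    gaussPDF d x = (2 * π) ^ (-(d : ℝ) / 2) * Real.exp (-(x ⬝ᵥ x) / 2) := by
  rw [gaussPDF, sum_sq_eq_dot]

lemma gaussPDF_nonneg (x : Fin d → ℝ) : 0 ≤ gaussPDF d x := by
  unfold gaussPDF; positivity

lemma gaussPDF_add (x y : Fin d → ℝ) :
    gaussPDF d (x + y) = gaussPDF d x * Real.exp (-(x ⬝ᵥ y) - (y ⬝ᵥ y) / 2) := by
  rw [gaussPDF_eq, gaussPDF_eq, mul_assoc, ← Real.exp_add]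
  congr 2
  simp only [add_dotProduct, dotProduct_add, dotProduct_comm y x]
  ring

lemma gaussPDF_line (x q : Fin d → ℝ) : HasLineDerivAt ℝ (gaussPDF d) (H1 q x * gaussPDF d x) x q := by
  unfold HasLineDerivAt
  have h : (fun t : ℝ => gaussPDF d (x + t • q)) =
      fun t => gaussPDF d x * Real.exp (-(t * (x ⬝ᵥ q)) - (t * t * (q ⬝ᵥ q)) / 2) := by
    ext t
    rw [gaussPDF_add]
    simp [smul_dotProduct, dotProduct_smul]
    left; ring
  rw [h]
  have h1 : HasDerivAt (fun t : ℝ => -(t * (x ⬝ᵥ q)) - (t * t * (q ⬝ᵥ q)) / 2) (-(x ⬝ᵥ q)) 0 := by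
    have := (((hasDerivAt_id (0:ℝ)).mul_const (x ⬝ᵥ q)).neg).sub
      ((((hasDerivAt_id (0:ℝ)).mul (hasDerivAt_id (0:ℝ))).mul_const (q ⬝ᵥ q)).div_const 2)
    exact this.congr_deriv (by simp)
  have := (h1.exp).const_mul (gaussPDF d x)
  exact this.congr_deriv (by simp [H1]; ring)

lemma H1_line (x q u : Fin d → ℝ) :
    HasLineDerivAt ℝ (fun x => H1 u x * gaussPDF d x) (H2 q u x * gaussPDF d x) x q := by
  have h2 := (hasDerivAt_dot_line x q u 0).neg
  have := h2.mul (gaussPDF_line x q)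
  exact HasDerivAt.congr_deriv this (by simp [H1, H2]; ring)

lemma H2_line (x q u w : Fin d → ℝ) :
    HasLineDerivAt ℝ (fun x => H2 u w x * gaussPDF d x) (H3 q u w x * gaussPDF d x) x q := by
  have h2 := ((hasDerivAt_dot_line x q u 0).mul (hasDerivAt_dot_line x q w 0)).sub_const (u ⬝ᵥ w)
  have := h2.mul (gaussPDF_line x q)
  exact HasDerivAt.congr_deriv this (by simp [H1, H3]; ring)

lemma gaussPDF_contDiff : ContDiff ℝ ⊤ (gaussPDF d) := by
  unfold gaussPDF; fun_prop

lemma dot_contDiff (u : Fin d → ℝ) : ContDiff ℝ ⊤ (fun x : Fin d → ℝ => x ⬝ᵥ u) := by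
  unfold dotProduct; fun_prop

lemma dot_cont (u : Fin d → ℝ) : Continuous (fun x : Fin d → ℝ => x ⬝ᵥ u) := (dot_contDiff u).continuous

lemma gaussPDF_cont : Continuous (gaussPDF d) := gaussPDF_contDiff.continuous

lemma gaussPDF3_eq (a c e : Fin d) (z : Fin d → ℝ) :
    gaussPDF3 d a c e z = H3 (Pi.single a 1) (Pi.single c 1) (Pi.single e 1) z * gaussPDF d z := by
  unfold gaussPDF3
  have e1 : (fun w₂ => fderiv ℝ (gaussPDF d) w₂ (Pi.single e 1)) =
      fun x => H1 (Pi.single e 1) x * gaussPDF d x := by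
    ext w
    rw [← (gaussPDF_line w (Pi.single e 1)).lineDeriv]
    exact ((gaussPDF_contDiff.differentiable (by simp)) w).lineDeriv_eq_fderiv.symm
  rw [e1]
  have e2 : (fun w₁ => fderiv ℝ (fun x => H1 (Pi.single e 1) x * gaussPDF d x) w₁ (Pi.single c 1)) =
      fun x => H2 (Pi.single c 1) (Pi.single e 1) x * gaussPDF d x := by
    ext w
    rw [← (H1_line w (Pi.single c 1) (Pi.single e 1)).lineDeriv]
    refine (DifferentiableAt.lineDeriv_eq_fderiv ?_).symm
    have := ((dot_contDiff (Pi.single e (1:ℝ) : Fin d → ℝ)).neg.mul gaussPDF_contDiff).differentiable (by simp)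
    exact this w
  rw [e2, ← (H2_line z (Pi.single a 1) (Pi.single c 1) (Pi.single e 1)).lineDeriv]
  refine (DifferentiableAt.lineDeriv_eq_fderiv ?_).symm
  have := (((dot_contDiff (Pi.single c (1:ℝ) : Fin d → ℝ)).mul (dot_contDiff (Pi.single e (1:ℝ) : Fin d → ℝ))).sub
    (contDiff_const (c := ((Pi.single c (1:ℝ) : Fin d → ℝ) ⬝ᵥ Pi.single e 1)))
    |>.mul gaussPDF_contDiff).differentiable (by simp)
  exact this z

lemma gauss_prod (d : ℕ) : gaussPDF d = fun x => ∏ i, ((2 * π) ^ (-(1 : ℝ) / 2) * Real.exp (-(1/2) * x i ^ 2)) := by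
  ext x
  rw [Finset.prod_mul_distrib, ← Real.exp_sum, gaussPDF, ← Finset.mul_sum]
  congr 1
  · rw [Finset.prod_const, ← Real.rpow_natCast, ← Real.rpow_mul (by positivity)]
    congr 1; simp; ring
  · congr 1; ring

lemma gauss_integrable_q (d : ℕ) (c : ℝ) (hc : 0 < c) :
    Integrable (fun x : Fin d → ℝ => Real.exp (-c * (x ⬝ᵥ x))) := by
  have : (fun x : Fin d → ℝ => Real.exp (-c * (x ⬝ᵥ x))) = fun x => ∏ i, Real.exp (-c * x i ^ 2) := by
    ext x
    rw [← Real.exp_sum, ← sum_sq_eq_dot, Finset.mul_sum]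
  rw [this]
  exact Integrable.fintype_prod (f := fun _ t => Real.exp (-c * t ^ 2)) (fun _ => integrable_exp_neg_mul_sq hc)

lemma gauss_int (d : ℕ) : ∫ x, gaussPDF d x = 1 := by
  rw [gauss_prod, integral_fintype_prod_volume_eq_prod (fun _ t => (2 * π) ^ (-(1 : ℝ) / 2) * Real.exp (-(1/2) * t ^ 2))]
  rw [Finset.prod_eq_one]
  intro i _
  rw [integral_const_mul, integral_gaussian, Real.sqrt_eq_rpow]
  rw [show π / (1/2) = 2 * π by ring, ← Real.rpow_add (by positivity)]
  norm_num

lemma gauss_integrable (d : ℕ) : Integrable (gaussPDF d) := by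
  by_contra h
  have := gauss_int d
  rw [integral_undef h] at this
  simp at this

lemma gauss_lint (d : ℕ) : ∫⁻ x, ENNReal.ofReal (gaussPDF d x) = 1 := by
  rw [← ofReal_integral_eq_lintegral_ofReal (gauss_integrable d) (Filter.Eventually.of_forall gaussPDF_nonneg), gauss_int]
  simp

/-- polynomially bounded times Gaussian is integrable -/
lemma poly_gauss_integrable (f : (Fin d → ℝ) → ℝ) (hf : Continuous f) (C : ℝ)
    (h : ∀ x, |f x| ≤ C * (1 + x ⬝ᵥ x) ^ 3) : Integrable (fun x => f x * gaussPDF d x) := by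
  have hb := (gauss_integrable_q d (1/4) (by norm_num)).const_mul ((2 * π) ^ (-(d : ℝ) / 2) * (|C| * 1728))
  refine hb.mono' ((hf.mul gaussPDF_cont).aestronglyMeasurable) (Filter.Eventually.of_forall fun x => ?_)
  rw [norm_mul, Real.norm_eq_abs, Real.norm_eq_abs, abs_of_nonneg (gaussPDF_nonneg x), gaussPDF_eq]
  set r := x ⬝ᵥ x with hr
  have hr0 : 0 ≤ r := by rw [hr, ← sum_sq_eq_dot]; positivity
  have h1 : (1 + r) ^ 3 ≤ 1728 * Real.exp (r / 4) := by
    have h2 : 1 + r / 12 ≤ Real.exp (r / 12) := by linarith [Real.add_one_le_exp (r / 12)]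
    have h3 : Real.exp (r / 4) = Real.exp (r / 12) ^ 3 := by rw [← Real.exp_nat_mul]; congr 1; push_cast; ring
    rw [h3]
    have h4 : (1 + r / 12) ^ 3 ≤ Real.exp (r / 12) ^ 3 := by gcongr
    have h5 : (1 + r) ^ 3 ≤ (12 * (1 + r / 12)) ^ 3 := by gcongr; linarith
    nlinarith
  have h5 : |f x| ≤ |C| * (1728 * Real.exp (r / 4)) :=
    (h x).trans (by
      have := le_abs_self C
      have h6 : C * (1 + r) ^ 3 ≤ |C| * (1 + r) ^ 3 := by gcongr
      have h7 : |C| * (1 + r) ^ 3 ≤ |C| * (1728 * Real.exp (r / 4)) := by gcongr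
      linarith)
  calc |f x| * ((2 * π) ^ (-(d : ℝ) / 2) * Real.exp (-r / 2))
      ≤ (|C| * (1728 * Real.exp (r / 4))) * ((2 * π) ^ (-(d : ℝ) / 2) * Real.exp (-r / 2)) := by gcongr
    _ = _ := by
      rw [show -(1/4) * r = r / 4 + -r / 2 by ring, Real.exp_add]; ring

lemma abs_dot_le (x u : Fin d → ℝ) : |x ⬝ᵥ u| ≤ (1 + u ⬝ᵥ u) * (1 + x ⬝ᵥ x) := by
  have h1 : (x ⬝ᵥ u) ^ 2 ≤ (x ⬝ᵥ x) * (u ⬝ᵥ u) := by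
    rw [← sum_sq_eq_dot, ← sum_sq_eq_dot]; exact Finset.sum_mul_sq_le_sq_mul_sq _ _ _
  have hx : 0 ≤ x ⬝ᵥ x := by rw [← sum_sq_eq_dot]; positivity
  have hu : 0 ≤ u ⬝ᵥ u := by rw [← sum_sq_eq_dot]; positivity
  apply abs_le_of_sq_le_sq _ (by positivity)
  nlinarith [mul_nonneg hx hu, mul_nonneg (mul_nonneg hx hu) hx,mul_nonneg (mul_nonneg hx hu) hu, sq_nonneg (x ⬝ᵥ x * u ⬝ᵥ u)]


lemma abs_H1_le (u x : Fin d → ℝ) : |H1 u x| ≤ (1 + u ⬝ᵥ u) * (1 + x ⬝ᵥ x) ^ 3 := by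
  have hx : 0 ≤ x ⬝ᵥ x := by rw [← sum_sq_eq_dot]; positivity
  have hu : 0 ≤ u ⬝ᵥ u := by rw [← sum_sq_eq_dot]; positivity
  rw [H1, abs_neg]
  refine (abs_dot_le x u).trans ?_
  gcongr
  exact le_self_pow₀ (by linarith) (by norm_num)

lemma H1_integrable (u : Fin d → ℝ) : Integrable (fun x => H1 u x * gaussPDF d x) :=
  poly_gauss_integrable (H1 u) (dot_cont u).neg _ (abs_H1_le u)

lemma H2_cont (u w : Fin d → ℝ) : Continuous (H2 u w) :=
  ((dot_cont u).mul (dot_cont w)).sub continuous_const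

lemma H3_cont (q u w : Fin d → ℝ) : Continuous (H3 q u w) :=
  (((((dot_cont q).mul (dot_cont u)).mul (dot_cont w)).neg.add ((dot_cont w).const_mul _)).add
    ((dot_cont u).const_mul _)).add ((dot_cont q).const_mul _)

lemma H2_integrable (u w : Fin d → ℝ) : Integrable (fun x => H2 u w x * gaussPDF d x) := by
  refine poly_gauss_integrable (H2 u w) (H2_cont u w) ((1 + u ⬝ᵥ u) * (1 + w ⬝ᵥ w) + |u ⬝ᵥ w|) fun x => ?_
  have hx : 0 ≤ x ⬝ᵥ x := by rw [← sum_sq_eq_dot]; positivity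
  have hu : 0 ≤ u ⬝ᵥ u := by rw [← sum_sq_eq_dot]; positivity
  have hw : 0 ≤ w ⬝ᵥ w := by rw [← sum_sq_eq_dot]; positivity
  have h1 : 1 ≤ (1 + x ⬝ᵥ x) ^ 3 := one_le_pow₀ (by linarith)
  have h2 : (1 + x ⬝ᵥ x) ^ 2 ≤ (1 + x ⬝ᵥ x) ^ 3 := pow_le_pow_right₀ (by linarith) (by norm_num)
  calc |H2 u w x| ≤ |x ⬝ᵥ u| * |x ⬝ᵥ w| + |u ⬝ᵥ w| := by
        rw [H2, ← abs_mul]; exact abs_sub _ _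
    _ ≤ ((1 + u ⬝ᵥ u) * (1 + x ⬝ᵥ x)) * ((1 + w ⬝ᵥ w) * (1 + x ⬝ᵥ x)) + |u ⬝ᵥ w| * 1 := by
        rw [mul_one]
        gcongr <;> exact abs_dot_le _ _
    _ = ((1 + u ⬝ᵥ u) * (1 + w ⬝ᵥ w)) * (1 + x ⬝ᵥ x) ^ 2 + |u ⬝ᵥ w| * 1 := by ring
    _ ≤ ((1 + u ⬝ᵥ u) * (1 + w ⬝ᵥ w)) * (1 + x ⬝ᵥ x) ^ 3 + |u ⬝ᵥ w| * (1 + x ⬝ᵥ x) ^ 3 := by gcongr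
    _ = _ := by ring

lemma H3_integrable (q u w : Fin d → ℝ) : Integrable (fun x => H3 q u w x * gaussPDF d x) := by
  have hm : Integrable (fun x => (-((x ⬝ᵥ q) * (x ⬝ᵥ u) * (x ⬝ᵥ w))) * gaussPDF d x) := by
    refine poly_gauss_integrable (fun x => -((x ⬝ᵥ q) * (x ⬝ᵥ u) * (x ⬝ᵥ w)))
      (((dot_cont q).mul (dot_cont u)).mul (dot_cont w)).neg
      ((1 + q ⬝ᵥ q) * (1 + u ⬝ᵥ u) * (1 + w ⬝ᵥ w)) fun x => ?_
    have hx : 0 ≤ x ⬝ᵥ x := by rw [← sum_sq_eq_dot]; positivity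
    have hu : 0 ≤ u ⬝ᵥ u := by rw [← sum_sq_eq_dot]; positivity
    have hq : 0 ≤ q ⬝ᵥ q := by rw [← sum_sq_eq_dot]; positivity
    rw [abs_neg, abs_mul, abs_mul]
    calc |x ⬝ᵥ q| * |x ⬝ᵥ u| * |x ⬝ᵥ w| ≤ ((1 + q ⬝ᵥ q) * (1 + x ⬝ᵥ x)) * ((1 + u ⬝ᵥ u) * (1 + x ⬝ᵥ x)) *
        ((1 + w ⬝ᵥ w) * (1 + x ⬝ᵥ x)) := by gcongr <;> exact abs_dot_le _ _
      _ = _ := by ring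
  have h := ((hm.add ((H1_integrable w).const_mul (-(q ⬝ᵥ u)))).add
    ((H1_integrable u).const_mul (-(q ⬝ᵥ w)))).add ((H1_integrable q).const_mul (-(u ⬝ᵥ w)))
  refine h.congr (Filter.Eventually.of_forall fun x => ?_)
  simp only [H3, H1, Pi.add_apply]; ring

section ibp
variable {v : Fin d → (Fin d → ℝ)} {b : Fin d → ℝ} {g ρ : ℝ → ℝ}

lemma GoodG.gcont (h : GoodG g ρ) : Continuous g :=
  continuous_iff_continuousAt.2 fun t => (h.deriv t).continuousAt

lemma gW_cont (h : GoodG g ρ) (S : Finset (Fin d)) : Continuous (gW v b g ρ S) := by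
  unfold gW
  refine Continuous.mul (continuous_finsetProd _ fun j _ => h.cont.comp (continuous_const.sub (dot_cont _)))
    (continuous_finsetProd _ fun j _ => h.gcont.comp (continuous_const.sub (dot_cont _)))

lemma gW_nonneg (h : GoodG g ρ) (S : Finset (Fin d)) (x : Fin d → ℝ) : 0 ≤ gW v b g ρ S x :=
  mul_nonneg (Finset.prod_nonneg fun _ _ => h.nonneg _) (Finset.prod_nonneg fun _ _ => h.gnonneg _)

lemma gW_le (h : GoodG g ρ) (S : Finset (Fin d)) (x : Fin d → ℝ) :
    gW v b g ρ S x ≤ ∏ j ∈ S, ρ (b j - x ⬝ᵥ v j) :=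
  mul_le_of_le_one_right (Finset.prod_nonneg fun _ _ => h.nonneg _)
    (Finset.prod_le_one (fun _ _ => h.gnonneg _) fun _ _ => h.gle _)

lemma gW_bdd (h : GoodG g ρ) (S : Finset (Fin d)) : ∃ B, ∀ x, ‖gW v b g ρ S x‖ ≤ B := by
  obtain ⟨B, hB, hB'⟩ := h.bdd
  refine ⟨∏ j ∈ S, B, fun x => ?_⟩
  rw [Real.norm_eq_abs, abs_of_nonneg (gW_nonneg h S x)]
  exact (gW_le h S x).trans (Finset.prod_le_prod (fun _ _ => h.nonneg _) fun _ _ => hB' _)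

lemma gW_integrable (h : GoodG g ρ) (S : Finset (Fin d)) {ψ : (Fin d → ℝ) → ℝ} (hψ : Integrable ψ) :
    Integrable (fun x => gW v b g ρ S x * ψ x) := by
  obtain ⟨B, hB⟩ := gW_bdd (v := v) (b := b) h S
  exact hψ.bdd_mul (gW_cont h S).aestronglyMeasurable (Filter.Eventually.of_forall hB)

lemma gW_insert (S : Finset (Fin d)) (k : Fin d) (hk : k ∈ Sᶜ) (x : Fin d → ℝ) :
    gW v b g ρ (insert k S) x =
      (∏ j ∈ S, ρ (b j - x ⬝ᵥ v j)) * ((∏ l ∈ Sᶜ.erase k, g (b l - x ⬝ᵥ v l)) * ρ (b k - x ⬝ᵥ v k)) := by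
  rw [gW, Finset.prod_insert (by simpa using hk), Finset.compl_insert]
  ring

lemma gW_line (h : GoodG g ρ) (S : Finset (Fin d)) (q : Fin d → ℝ) (hq : ∀ j ∈ S, q ⬝ᵥ v j = 0)
    (x : Fin d → ℝ) :
    HasLineDerivAt ℝ (gW v b g ρ S) (-∑ k ∈ Sᶜ, (q ⬝ᵥ v k) * gW v b g ρ (insert k S) x) x q := by
  have e : (fun t : ℝ => gW v b g ρ S (x + t • q)) =
      fun t => (∏ j ∈ S, ρ (b j - x ⬝ᵥ v j)) * ∏ l ∈ Sᶜ, g (b l - (x + t • q) ⬝ᵥ v l) := by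
    ext t
    rw [gW]
    congr 1
    refine Finset.prod_congr rfl fun j hj => ?_
    rw [dot_line, hq j hj]; simp
  unfold HasLineDerivAt
  rw [e]
  have h1 : ∀ l ∈ Sᶜ, HasDerivAt (fun t : ℝ => g (b l - (x + t • q) ⬝ᵥ v l))
      (ρ (b l - x ⬝ᵥ v l) * (-(q ⬝ᵥ v l))) 0 := by
    intro l _
    have h2 := (hasDerivAt_dot_line x q (v l) 0).const_sub (b l)
    have h3 := h.deriv (b l - (x + (0:ℝ) • q) ⬝ᵥ v l)
    have := HasDerivAt.comp (0:ℝ) h3 h2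
    exact this.congr_deriv (by simp)
  refine ((HasDerivAt.fun_finsetProd h1).const_mul _).congr_deriv ?_
  rw [Finset.mul_sum, ← Finset.sum_neg_distrib]
  refine Finset.sum_congr rfl fun k hk => ?_
  rw [gW_insert S k hk]
  simp
  ring

lemma gW_ibp (h : GoodG g ρ) (S : Finset (Fin d)) (q : Fin d → ℝ) (hq : ∀ j ∈ S, q ⬝ᵥ v j = 0)
    {ψ ψ' : (Fin d → ℝ) → ℝ} (hψ : ∀ x, HasLineDerivAt ℝ ψ (ψ' x) x q)
    (iψ : Integrable ψ) (iψ' : Integrable ψ') :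
    ∫ x, gW v b g ρ S x * ψ' x = ∑ k ∈ Sᶜ, (q ⬝ᵥ v k) * ∫ x, gW v b g ρ (insert k S) x * ψ x := by
  have i1 : ∀ k, Integrable (fun x => (q ⬝ᵥ v k) * (gW v b g ρ (insert k S) x * ψ x)) :=
    fun k => (gW_integrable h _ iψ).const_mul _
  have e1 : ∀ x, (-∑ k ∈ Sᶜ, (q ⬝ᵥ v k) * gW v b g ρ (insert k S) x) * ψ x =
      -∑ k ∈ Sᶜ, (q ⬝ᵥ v k) * (gW v b g ρ (insert k S) x * ψ x) := by
    intro x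
    rw [neg_mul, Finset.sum_mul]
    simp only [mul_assoc]
  have := integral_bilinear_hasLineDerivAt_right_eq_neg_left_of_integrable (μ := (volume : Measure (Fin d → ℝ)))
    (f := gW v b g ρ S) (f' := fun x => -∑ k ∈ Sᶜ, (q ⬝ᵥ v k) * gW v b g ρ (insert k S) x)
    (g := ψ) (g' := ψ') (v := q) (B := ContinuousLinearMap.mul ℝ ℝ)
    (by
      simp only [ContinuousLinearMap.mul_apply', e1]
      exact (integrable_finsetSum _ fun k _ => i1 k).neg)
    (gW_integrable h S iψ') (gW_integrable h S iψ) (fun x _ => gW_line h S q hq x) (fun x _ => hψ x)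
  simp only [ContinuousLinearMap.mul_apply', e1] at this
  rw [this, integral_neg, neg_neg, integral_finsetSum _ fun k _ => i1 k]
  simp only [integral_const_mul]

end ibp
end gauss

open MeasureTheory Matrix Real

/-- Gram matrix of a tuple -/
noncomputable def Gm {d m : ℕ} (v : Fin d → (Fin d → ℝ)) (σ : Fin m → Fin d) : Matrix (Fin m) (Fin m) ℝ :=
  Matrix.of fun i k => v (σ i) ⬝ᵥ v (σ k)

/-- linear combination -/
noncomputable def cmb {d m : ℕ} (v : Fin d → (Fin d → ℝ)) (σ : Fin m → Fin d) (t : Fin m → ℝ) : Fin d → ℝ :=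
  ∑ i, t i • v (σ i)

section meas
variable {d m : ℕ} {v : Fin d → (Fin d → ℝ)} {b : Fin d → ℝ} {g ρ : ℝ → ℝ} {σ : Fin m → Fin d}

lemma dot_cmb (x : Fin d → ℝ) (t : Fin m → ℝ) : x ⬝ᵥ cmb v σ t = ∑ i, t i * (x ⬝ᵥ v (σ i)) := by
  unfold cmb
  rw [dotProduct_sum]
  simp [dotProduct_smul]

lemma cmb_dot (t : Fin m → ℝ) (i : Fin m) : cmb v σ t ⬝ᵥ v (σ i) = (Gm v σ *ᵥ t) i := by
  rw [dotProduct_comm, dot_cmb]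
  simp [Gm, mulVec, dotProduct, mul_comm]

lemma cmb_add (s t : Fin m → ℝ) : cmb v σ (s + t) = cmb v σ s + cmb v σ t := by
  simp [cmb, add_smul, Finset.sum_add_distrib]

lemma cmb_neg (t : Fin m → ℝ) : cmb v σ (-t) = - cmb v σ t := by
  simp [cmb]

lemma cmb_smul (c : ℝ) (t : Fin m → ℝ) : cmb v σ (c • t) = c • cmb v σ t := by
  simp [cmb, smul_smul, Finset.smul_sum]

lemma cmb_cont : Continuous (cmb v σ) := by
  unfold cmb; fun_prop

lemma cov_lint (M : Matrix (Fin m) (Fin m) ℝ) (hM : 0 < M.det) (a : Fin m → ℝ)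
    (f : (Fin m → ℝ) → ENNReal) (hf : Measurable f) :
    ENNReal.ofReal M.det * ∫⁻ t, f (M *ᵥ t + a) = ∫⁻ t, f t := by
  have h1 := Real.map_matrix_volume_pi_eq_smul_volume_pi (M := M) hM.ne'
  have hmeas : Measurable (Matrix.toLin' M) := (LinearMap.continuous_of_finiteDimensional _).measurable
  have h2 : ∫⁻ t, f (M *ᵥ t + a) = ∫⁻ y, f (y + a) ∂(Measure.map (Matrix.toLin' M) volume) := by
    have hfa : Measurable (fun y => f (y + a)) := hf.comp (measurable_id.add_const a)
    rw [lintegral_map hfa hmeas]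
    simp [Matrix.toLin'_apply]
  rw [h2, h1, lintegral_smul_measure, lintegral_add_right_eq_self (fun y => f y) a, smul_eq_mul, ← mul_assoc,
    ← ENNReal.ofReal_mul hM.le, abs_of_pos (inv_pos.2 hM), mul_inv_cancel₀ hM.ne']
  simp

lemma prod_lint {ι : Type*} [Fintype ι] (f : ι → ℝ → ℝ) (hf : ∀ i, Integrable (f i)) (h0 : ∀ i t, 0 ≤ f i t) :
    ∫⁻ x : ι → ℝ, ENNReal.ofReal (∏ i, f i (x i)) = ENNReal.ofReal (∏ i, ∫ t, f i t) := by
  rw [← integral_fintype_prod_volume_eq_prod f, ofReal_integral_eq_lintegral_ofReal]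
  · exact Integrable.fintype_prod hf
  · exact Filter.Eventually.of_forall fun x => Finset.prod_nonneg fun i _ => h0 i _

lemma split_lint (hσ : Function.Injective σ) :
    ∃ mrg : (Fin m → ℝ) → ({l // l ∉ Set.range σ} → ℝ) → (Fin d → ℝ),
      (∀ a c i, mrg a c (σ i) = a i) ∧ (∀ a c l, mrg a c l.1 = c l) ∧
      ∀ F : (Fin d → ℝ) → ENNReal, Measurable F → ∫⁻ s, F s = ∫⁻ a, ∫⁻ c, F (mrg a c) := by
  classical
  let e : Fin m ⊕ {l // l ∉ Set.range σ} ≃ Fin d :=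
    (Equiv.sumCongr (Equiv.ofInjective σ hσ) (Equiv.refl _)).trans (Equiv.Set.sumCompl (Set.range σ))
  have he1 : ∀ i, e (Sum.inl i) = σ i := fun i => rfl
  have he2 : ∀ l, e (Sum.inr l) = l.1 := fun l => rfl
  let P1 := volume_measurePreserving_piCongrLeft (fun _ : Fin d => ℝ) e
  let P2 := volume_measurePreserving_sumPiEquivProdPi_symm (fun _ : Fin m ⊕ {l // l ∉ Set.range σ} => ℝ)
  have P := P1.comp P2
  refine ⟨fun a c => MeasurableEquiv.piCongrLeft (fun _ : Fin d => ℝ) e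
    ((MeasurableEquiv.sumPiEquivProdPi (fun _ : Fin m ⊕ {l // l ∉ Set.range σ} => ℝ)).symm (a, c)), ?_, ?_, ?_⟩
  · intro a c i
    rw [← he1]
    exact Equiv.piCongrLeft_sumInl (fun _ : Fin d => ℝ) e a c i
  · intro a c l
    rw [← he2]
    exact Equiv.piCongrLeft_sumInr (fun _ : Fin d => ℝ) e a c l
  · intro F hF
    rw [← P.lintegral_comp hF]
    exact lintegral_prod _ (hF.comp P.measurable).aemeasurable

/-- multipliers -/
noncomputable def tauS (v : Fin d → (Fin d → ℝ)) (b : Fin d → ℝ) (σ : Fin m → Fin d) (y : Fin d → ℝ)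
    (a : Fin m → ℝ) : Fin m → ℝ :=
  (Gm v σ)⁻¹ *ᵥ (fun i => a i - (b (σ i) - y ⬝ᵥ v (σ i)))

/-- the event that the projection lies in a face -/
def Eset (v : Fin d → (Fin d → ℝ)) (b : Fin d → ℝ) (σ : Fin m → Fin d) (y : Fin d → ℝ) : Set (Fin d → ℝ) :=
  {s | (∀ i, 0 < tauS v b σ y (fun i => s (σ i)) i) ∧
    ∀ l, l ∉ Set.range σ → s l ≤ b l - (y - cmb v σ (tauS v b σ y (fun i => s (σ i)))) ⬝ᵥ v l}

lemma tauS_cont (y : Fin d → ℝ) : Continuous (tauS v b σ y) := by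
  unfold tauS
  exact Continuous.matrix_mulVec continuous_const (by fun_prop)

lemma Eset_meas (y : Fin d → ℝ) : MeasurableSet (Eset v b σ y) := by
  have hc : Continuous (fun s : Fin d → ℝ => tauS v b σ y (fun i => s (σ i))) :=
    (tauS_cont y).comp (by fun_prop)
  unfold Eset
  have : {s : Fin d → ℝ | (∀ i, 0 < tauS v b σ y (fun i => s (σ i)) i) ∧
    ∀ l, l ∉ Set.range σ → s l ≤ b l - (y - cmb v σ (tauS v b σ y (fun i => s (σ i)))) ⬝ᵥ v l} =
    (⋂ i, {s | 0 < tauS v b σ y (fun i => s (σ i)) i}) ∩ ⋂ l, ⋂ (_ : l ∉ Set.range σ),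
      {s | s l ≤ b l - (y - cmb v σ (tauS v b σ y (fun i => s (σ i)))) ⬝ᵥ v l} := by
    ext s; simp
  rw [this]
  refine MeasurableSet.inter (MeasurableSet.iInter fun i => ?_)
    (MeasurableSet.iInter fun l => MeasurableSet.iInter fun _ => ?_)
  · exact measurableSet_lt measurable_const ((continuous_apply i).comp hc).measurable
  · refine measurableSet_le (measurable_pi_apply l) (Continuous.measurable ?_)
    exact continuous_const.sub ((dot_cont (v l)).comp (continuous_const.sub (cmb_cont.comp hc)))

lemma tauS_apply (hdet : 0 < (Gm v σ).det) (y : Fin d → ℝ) (t : Fin m → ℝ) :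
    tauS v b σ y (Gm v σ *ᵥ t + fun i => (b (σ i) - y ⬝ᵥ v (σ i))) = t := by
  unfold tauS
  have : (fun i => (Gm v σ *ᵥ t + fun i => (b (σ i) - y ⬝ᵥ v (σ i))) i - (b (σ i) - y ⬝ᵥ v (σ i)))
      = Gm v σ *ᵥ t := by ext i; simp
  rw [this, mulVec_mulVec, nonsing_inv_mul _ (isUnit_iff_ne_zero.2 hdet.ne'), one_mulVec]

lemma Gm_tauS (hdet : 0 < (Gm v σ).det) (y : Fin d → ℝ) (a : Fin m → ℝ) (i : Fin m) :
    (y - cmb v σ (tauS v b σ y a)) ⬝ᵥ v (σ i) = b (σ i) - a i := by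
  rw [sub_dotProduct, cmb_dot]
  unfold tauS
  rw [mulVec_mulVec, mul_nonsing_inv _ (isUnit_iff_ne_zero.2 hdet.ne'), one_mulVec]
  ring

lemma E_lint (h : GoodG g ρ) (hσ : Function.Injective σ) (hdet : 0 < (Gm v σ).det) (y : Fin d → ℝ) :
    ENNReal.ofReal (Gm v σ).det * ∫⁻ t in {t : Fin m → ℝ | ∀ i, 0 < t i},
      ENNReal.ofReal (gW v b g ρ (Finset.univ.image σ) (y - cmb v σ t)) =
    ∫⁻ s, (Eset v b σ y).indicator (fun s => ENNReal.ofReal (∏ j, ρ (s j))) s := by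
  classical
  obtain ⟨mrg, m1, m2, m3⟩ := split_lint hσ
  have hρm : Measurable (fun s : Fin d → ℝ => ENNReal.ofReal (∏ j, ρ (s j))) :=
    ENNReal.measurable_ofReal.comp (continuous_finsetProd _ fun j _ => h.cont.comp (continuous_apply j)).measurable
  rw [m3 _ (hρm.indicator (Eset_meas y))]
  set pos : Set (Fin m → ℝ) := {t | ∀ i, 0 < t i} with hpos
  have hposm : MeasurableSet pos := by
    have : pos = ⋂ i, {t | 0 < t i} := by ext; simp [pos]
    rw [this]
    exact MeasurableSet.iInter fun i => measurableSet_lt measurable_const (measurable_pi_apply i)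
  have prodsub : ∀ f : Fin d → ℝ, ∏ l ∈ (Finset.univ.image σ)ᶜ, f l = ∏ l : {l // l ∉ Set.range σ}, f l.1 := by
    intro f
    exact Finset.prod_subtype _ (by intro x; simp) f
  have prodim : ∀ f : Fin d → ℝ, ∏ l ∈ Finset.univ.image σ, f l = ∏ i, f (σ i) := by
    intro f
    exact Finset.prod_image (fun _ _ _ _ h => hσ h)
  set p : (Fin m → ℝ) → Fin d → ℝ := fun a => y - cmb v σ (tauS v b σ y a) with hp
  set F : (Fin m → ℝ) → ENNReal := fun a => (tauS v b σ y ⁻¹' pos).indicator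
    (fun a => ENNReal.ofReal ((∏ i, ρ (a i)) * ∏ l : {l // l ∉ Set.range σ}, g (b l.1 - p a ⬝ᵥ v l.1))) a with hF
  have hpc : Continuous p := continuous_const.sub (cmb_cont.comp (tauS_cont y))
  have hFm : Measurable F := by
    refine Measurable.indicator ?_ ((tauS_cont y).measurable hposm)
    refine ENNReal.measurable_ofReal.comp (Continuous.measurable ?_)
    refine Continuous.mul (continuous_finsetProd _ fun j _ => h.cont.comp (continuous_apply j))
      (continuous_finsetProd _ fun j _ => h.gcont.comp (continuous_const.sub ((dot_cont _).comp hpc)))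
  have inner : ∀ a, ∫⁻ c, (Eset v b σ y).indicator (fun s => ENNReal.ofReal (∏ j, ρ (s j))) (mrg a c) = F a := by
    intro a
    have hm1 : ∀ c, (fun i => mrg a c (σ i)) = a := fun c => by ext i; exact m1 a c i
    by_cases ha : tauS v b σ y a ∈ pos
    · have e1 : ∀ c, (Eset v b σ y).indicator (fun s => ENNReal.ofReal (∏ j, ρ (s j))) (mrg a c) =
          ENNReal.ofReal (∏ i, ρ (a i)) * ENNReal.ofReal (∏ l : {l // l ∉ Set.range σ},
            (Set.Iic (b l.1 - p a ⬝ᵥ v l.1)).indicator ρ (c l)) := by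
        intro c
        have e2 : ∏ j, ρ (mrg a c j) = (∏ i, ρ (a i)) * ∏ l : {l // l ∉ Set.range σ}, ρ (c l) := by
          rw [← Finset.prod_mul_prod_compl (Finset.univ.image σ), prodim, prodsub]
          simp only [m1, m2]
        by_cases hc : ∀ l : {l // l ∉ Set.range σ}, c l ≤ b l.1 - p a ⬝ᵥ v l.1
        · rw [Set.indicator_of_mem, e2, ENNReal.ofReal_mul (Finset.prod_nonneg fun _ _ => h.nonneg _)]
          · congr 2
            refine Finset.prod_congr rfl fun l _ => ?_
            rw [Set.indicator_of_mem]
            exact hc l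
          · refine ⟨?_, ?_⟩
            · rw [hm1]; exact ha
            · intro l hl
              rw [hm1]
              have := hc ⟨l, hl⟩
              rwa [← m2 a c] at this
        · rw [Set.indicator_of_notMem]
          · push Not at hc
            obtain ⟨l, hl⟩ := hc
            rw [Finset.prod_eq_zero (Finset.mem_univ l)]
            · simp
            · rw [Set.indicator_of_notMem]
              simpa using hl
          · rintro ⟨-, h2⟩
            apply hc
            intro l
            have := h2 l.1 l.2
            rwa [hm1, m2] at this
      simp_rw [e1]
      rw [lintegral_const_mul' _ _ ENNReal.ofReal_ne_top, prod_lint]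
      · simp only [hF]
        rw [Set.indicator_of_mem (by exact ha), ENNReal.ofReal_mul (Finset.prod_nonneg fun _ _ => h.nonneg _)]
        congr 2
        refine Finset.prod_congr rfl fun l _ => ?_
        rw [integral_indicator measurableSet_Iic, h.int_Iic]
      · intro l
        exact h.integrable.indicator measurableSet_Iic
      · intro l t
        exact Set.indicator_nonneg (fun _ _ => h.nonneg _) _
    · simp only [hF]
      rw [Set.indicator_of_notMem (by exact ha)]
      have : ∀ c, (Eset v b σ y).indicator (fun s => ENNReal.ofReal (∏ j, ρ (s j))) (mrg a c) = 0 := by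
        intro c
        rw [Set.indicator_of_notMem]
        rintro ⟨h1, -⟩
        rw [hm1] at h1
        exact ha h1
      simp [this]
  simp_rw [inner]
  rw [← cov_lint (Gm v σ) hdet (fun i => (b (σ i) - y ⬝ᵥ v (σ i))) F hFm, ← lintegral_indicator hposm]
  congr 1
  refine lintegral_congr fun t => ?_
  simp only [hF, hp]
  by_cases ht : t ∈ pos
  · rw [Set.indicator_of_mem ht, Set.indicator_of_mem, tauS_apply hdet, gW, prodim, prodsub]
    · congr 2
      refine Finset.prod_congr rfl fun i _ => ?_
      rw [sub_dotProduct, cmb_dot]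
      simp only [Pi.add_apply]
      congr 1; ring
    · rw [Set.mem_preimage, tauS_apply hdet]; exact ht
  · rw [Set.indicator_of_notMem ht, Set.indicator_of_notMem]
    rw [Set.mem_preimage, tauS_apply hdet]; exact ht

end meas

open MeasureTheory Matrix Real

section meas2
variable {d m : ℕ} {v : Fin d → (Fin d → ℝ)} {b : Fin d → ℝ} {g ρ : ℝ → ℝ} {σ : Fin m → Fin d}

lemma Eset_feas (hdet : 0 < (Gm v σ).det) {y s : Fin d → ℝ} (hs : s ∈ Eset v b σ y) (l : Fin d) :
    (y - cmb v σ (tauS v b σ y (fun i => s (σ i)))) ⬝ᵥ v l ≤ b l - s l := by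
  by_cases hl : l ∈ Set.range σ
  · obtain ⟨i, rfl⟩ := hl
    rw [Gm_tauS hdet]
  · have := hs.2 l hl
    linarith

lemma Eset_var (hdet : 0 < (Gm v σ).det) {y s p' : Fin d → ℝ} (hs : s ∈ Eset v b σ y)
    (hp' : ∀ l, p' ⬝ᵥ v l ≤ b l - s l) :
    (y - (y - cmb v σ (tauS v b σ y (fun i => s (σ i))))) ⬝ᵥ
      (p' - (y - cmb v σ (tauS v b σ y (fun i => s (σ i))))) ≤ 0 := by
  rw [sub_sub_cancel, dotProduct_comm, dot_cmb]
  refine Finset.sum_nonpos fun i _ => ?_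
  refine mul_nonpos_of_nonneg_of_nonpos (hs.1 i).le ?_
  rw [sub_dotProduct, Gm_tauS hdet]
  linarith [hp' (σ i)]

lemma dot_self_nonpos {x : Fin d → ℝ} (h : x ⬝ᵥ x ≤ 0) : x = 0 := by
  rw [← sum_sq_eq_dot] at h
  have h2 : ∑ i, x i ^ 2 = 0 := le_antisymm h (by positivity)
  rw [Finset.sum_eq_zero_iff_of_nonneg (fun i _ => by positivity)] at h2
  ext i
  simpa using h2 i (Finset.mem_univ i)

lemma Eset_unique {σ' : Fin m → Fin d} (hdet : 0 < (Gm v σ).det) (hdet' : 0 < (Gm v σ').det)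
    {y s : Fin d → ℝ} (hs : s ∈ Eset v b σ y) (hs' : s ∈ Eset v b σ' y) (i : Fin m) :
    s (σ' i) = b (σ' i) - (y - cmb v σ (tauS v b σ y (fun i => s (σ i)))) ⬝ᵥ v (σ' i) := by
  have h1 := Eset_var hdet hs (Eset_feas hdet' hs')
  have h2 := Eset_var hdet' hs' (Eset_feas hdet hs)
  have h3 := Gm_tauS (b := b) hdet' y (fun i => s (σ' i)) i
  set p := (y - cmb v σ (tauS v b σ y (fun i => s (σ i))))
  set p' := (y - cmb v σ' (tauS v b σ' y (fun i => s (σ' i))))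
  have h4 : (p' - p) ⬝ᵥ (p' - p) = (y - p) ⬝ᵥ (p' - p) + (y - p') ⬝ᵥ (p - p') := by
    simp only [sub_dotProduct, dotProduct_sub]; ring
  have h5 : p' - p = 0 := dot_self_nonpos (by linarith)
  rw [← sub_eq_zero.1 h5, h3]
  ring

lemma null_hyper (j : Fin d) (hj : j ∉ Set.range σ) (y : Fin d → ℝ) :
    volume {s : Fin d → ℝ | s j = b j - (y - cmb v σ (tauS v b σ y (fun i => s (σ i)))) ⬝ᵥ v j} = 0 := by
  let f : (Fin d → ℝ) →ₗ[ℝ] ℝ :=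
    { toFun := fun s => s j - cmb v σ ((Gm v σ)⁻¹ *ᵥ (fun i => s (σ i))) ⬝ᵥ v j
      map_add' := by
        intro s t
        have : (fun i => (s + t) (σ i)) = (fun i => s (σ i)) + (fun i => t (σ i)) := rfl
        rw [this, mulVec_add, cmb_add, add_dotProduct]
        simp; ring
      map_smul' := by
        intro c s
        have : (fun i => (c • s) (σ i)) = c • (fun i => s (σ i)) := rfl
        rw [this, mulVec_smul, cmb_smul, smul_dotProduct]
        simp; ring }
  have hsurj : Function.Surjective f := by
    intro c
    refine ⟨Pi.single j c, ?_⟩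
    have : (fun i => (Pi.single j c : Fin d → ℝ) (σ i)) = 0 := by
      ext i
      have : σ i ≠ j := fun h => hj ⟨i, h⟩
      simp [this]
    simp [f, this, cmb]
  obtain ⟨c, -, hc⟩ := LinearMap.exists_map_addHaar_eq_smul_addHaar f (volume : Measure (Fin d → ℝ)) (volume : Measure ℝ) hsurj
  have hfm : Measurable f := (LinearMap.continuous_of_finiteDimensional f).measurable
  set κ : ℝ := b j - y ⬝ᵥ v j - cmb v σ ((Gm v σ)⁻¹ *ᵥ (fun i => b (σ i) - y ⬝ᵥ v (σ i))) ⬝ᵥ v j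
  have hsub : {s : Fin d → ℝ | s j = b j - (y - cmb v σ (tauS v b σ y (fun i => s (σ i)))) ⬝ᵥ v j} ⊆ f ⁻¹' {κ} := by
    intro s hs
    simp only [Set.mem_ofPred_eq] at hs
    have e : tauS v b σ y (fun i => s (σ i)) = (Gm v σ)⁻¹ *ᵥ (fun i => s (σ i)) +
        -((Gm v σ)⁻¹ *ᵥ (fun i => b (σ i) - y ⬝ᵥ v (σ i))) := by
      unfold tauS
      rw [← sub_eq_add_neg, ← mulVec_sub]
      rfl
    rw [e, cmb_add, cmb_neg, sub_dotProduct, add_dotProduct, neg_dotProduct] at hs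
    simp only [Set.mem_preimage, Set.mem_singleton_iff]
    change s j - cmb v σ ((Gm v σ)⁻¹ *ᵥ (fun i => s (σ i))) ⬝ᵥ v j = κ
    simp only [κ]
    linarith
  refine measure_mono_null hsub ?_
  rw [← Measure.map_apply hfm (measurableSet_singleton κ), hc]
  simp

lemma rho_tot (h : GoodG g ρ) (n : ℕ) : ∫⁻ s : Fin n → ℝ, ENNReal.ofReal (∏ j, ρ (s j)) = 1 := by
  rw [prod_lint (fun _ => ρ) (fun _ => h.integrable) (fun _ => h.nonneg)]
  simp [h.int_tot]

lemma sum_E (h : GoodG g ρ) (Sg : Finset (Fin m → Fin d)) 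
    (hdet : ∀ σ ∈ Sg, 0 < (Gm v σ).det) (y : Fin d → ℝ) :
    ∑ σ ∈ Sg, ∫⁻ s, (Eset v b σ y).indicator (fun s => ENNReal.ofReal (∏ j, ρ (s j))) s ≤ ((m ^ m : ℕ) : ENNReal) := by
  classical
  have hρm : Measurable (fun s : Fin d → ℝ => ENNReal.ofReal (∏ j, ρ (s j))) :=
    ENNReal.measurable_ofReal.comp (continuous_finsetProd _ fun j _ => h.cont.comp (continuous_apply j)).measurable
  rw [← lintegral_finsetSum _ fun σ _ => hρm.indicator (Eset_meas y)]
  have hN : ∀ᵐ s : Fin d → ℝ, ∀ σ : Fin m → Fin d, ∀ j, j ∉ Set.range σ →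
      ¬ (s j = b j - (y - cmb v σ (tauS v b σ y (fun i => s (σ i)))) ⬝ᵥ v j) := by
    rw [ae_all_iff]; intro σ
    rw [ae_all_iff]; intro j
    by_cases hj : j ∈ Set.range σ
    · exact Filter.Eventually.of_forall fun s h => absurd hj h
    · have := null_hyper (v := v) (b := b) j hj y
      rw [measure_eq_zero_iff_ae_notMem] at this
      filter_upwards [this] with s hs _
      exact hs
  calc ∫⁻ s, ∑ σ ∈ Sg, (Eset v b σ y).indicator (fun s => ENNReal.ofReal (∏ j, ρ (s j))) s
      ≤ ∫⁻ s : Fin d → ℝ, ((m ^ m : ℕ) : ENNReal) * ENNReal.ofReal (∏ j, ρ (s j)) := by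
        refine lintegral_mono_ae ?_
        filter_upwards [hN] with s hs
        have e : ∑ σ ∈ Sg, (Eset v b σ y).indicator (fun s => ENNReal.ofReal (∏ j, ρ (s j))) s =
            ((Sg.filter (fun σ => s ∈ Eset v b σ y)).card : ENNReal) * ENNReal.ofReal (∏ j, ρ (s j)) := by
          simp only [Set.indicator_apply]
          rw [← Finset.sum_filter, Finset.sum_const, nsmul_eq_mul]
        rw [e]
        gcongr
        rcases (Sg.filter (fun σ => s ∈ Eset v b σ y)).eq_empty_or_nonempty with h0 | ⟨σ₀, h0⟩
        · rw [h0]; simp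
        · rw [Finset.mem_filter] at h0
          have hsub : (Sg.filter (fun σ => s ∈ Eset v b σ y)) ⊆
              Fintype.piFinset (fun _ : Fin m => Finset.univ.image σ₀) := by
            intro σ hσ
            rw [Finset.mem_filter] at hσ
            rw [Fintype.mem_piFinset]
            intro i
            by_contra hi
            refine hs σ₀ (σ i) (by simpa using hi) ?_
            exact Eset_unique (hdet _ h0.1) (hdet _ hσ.1) h0.2 hσ.2 i
          refine (Finset.card_le_card hsub).trans ?_
          rw [Fintype.card_piFinset_const]
          refine Nat.pow_le_pow_left ?_ _ |>.trans (le_of_eq rfl)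
          exact Finset.card_image_le.trans (by simp)
    _ = _ := by
        rw [lintegral_const_mul _ hρm, rho_tot h]; simp

lemma tonelli (φ F : (Fin d → ℝ) → ENNReal) (hφ : Measurable φ) (hF : Measurable F) (U : Set (Fin m → ℝ)) :
    ∫⁻ y, φ y * ∫⁻ t in U, F (y - cmb v σ t) = ∫⁻ x, F x * ∫⁻ t in U, φ (x + cmb v σ t) := by
  have hc : Measurable (cmb v σ) := cmb_cont.measurable
  have m1 : ∀ y, Measurable (fun t => F (y - cmb v σ t)) := fun y => hF.comp (measurable_const.sub hc)
  have m2 : ∀ y, Measurable (fun t => φ (y + cmb v σ t)) := fun y => hφ.comp (measurable_const.add hc)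
  simp_rw [← lintegral_const_mul _ (m1 _), ← lintegral_const_mul _ (m2 _)]
  have q1 : AEMeasurable (Function.uncurry fun y t => φ y * F (y - cmb v σ t))
      ((volume : Measure (Fin d → ℝ)).prod (volume.restrict U)) :=
    ((hφ.comp measurable_fst).mul (hF.comp (measurable_fst.sub (hc.comp measurable_snd)))).aemeasurable
  have q2 : AEMeasurable (Function.uncurry fun x t => F x * φ (x + cmb v σ t))
      ((volume : Measure (Fin d → ℝ)).prod (volume.restrict U)) :=
    ((hF.comp measurable_fst).mul (hφ.comp (measurable_fst.add (hc.comp measurable_snd)))).aemeasurable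
  rw [lintegral_lintegral_swap q1, lintegral_lintegral_swap q2]
  refine lintegral_congr fun t => ?_
  rw [← lintegral_add_right_eq_self (fun y => φ y * F (y - cmb v σ t)) (cmb v σ t)]
  simp only [add_sub_cancel_right, mul_comm]

end meas2

section ptwise
open MeasureTheory Matrix Real
open scoped Pointwise

/-- coefficients of the projection on the span -/
noncomputable def tauX {d m : ℕ} (v : Fin d → (Fin d → ℝ)) (σ : Fin m → Fin d) (x : Fin d → ℝ) : Fin m → ℝ :=
  (Gm v σ)⁻¹ *ᵥ (fun i => x ⬝ᵥ v (σ i))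

/-- squared norm of the projection on the span -/
noncomputable def Qx {d m : ℕ} (v : Fin d → (Fin d → ℝ)) (σ : Fin m → Fin d) (x : Fin d → ℝ) : ℝ :=
  cmb v σ (tauX v σ x) ⬝ᵥ cmb v σ (tauX v σ x)

/-- part of the cone in the unit ball, in coefficient coordinates -/
def coneB {d m : ℕ} (v : Fin d → (Fin d → ℝ)) (σ : Fin m → Fin d) (r : ℝ) : Set (Fin m → ℝ) :=
  {t | (∀ i, 0 < t i) ∧ cmb v σ t ⬝ᵥ cmb v σ t ≤ r}

section bounds
variable {d m : ℕ} {v : Fin d → (Fin d → ℝ)} {b : Fin d → ℝ} {g ρ : ℝ → ℝ} {σ : Fin m → Fin d}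

lemma dot_self_nonneg' (x : Fin d → ℝ) : 0 ≤ x ⬝ᵥ x := by rw [← sum_sq_eq_dot]; positivity

lemma dot_sq_le (x y : Fin d → ℝ) : (x ⬝ᵥ y) ^ 2 ≤ (x ⬝ᵥ x) * (y ⬝ᵥ y) := by
  rw [← sum_sq_eq_dot, ← sum_sq_eq_dot]; exact Finset.sum_mul_sq_le_sq_mul_sq _ _ _

lemma Qx_nonneg (x : Fin d → ℝ) : 0 ≤ Qx v σ x := dot_self_nonneg' _

lemma tauX_cont : Continuous (tauX v σ) := by
  unfold tauX
  exact Continuous.matrix_mulVec continuous_const (continuous_pi fun i => dot_cont _)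

lemma cmbcmb_cont : Continuous (fun t => cmb v σ t ⬝ᵥ cmb v σ t) := by
  unfold dotProduct
  exact continuous_finsetSum _ fun i _ => ((continuous_apply i).comp cmb_cont).mul ((continuous_apply i).comp cmb_cont)

lemma Qx_cont : Continuous (Qx v σ) := cmbcmb_cont.comp tauX_cont

lemma tauX_dot (hdet : 0 < (Gm v σ).det) (x : Fin d → ℝ) (i : Fin m) :
    cmb v σ (tauX v σ x) ⬝ᵥ v (σ i) = x ⬝ᵥ v (σ i) := by
  rw [cmb_dot]
  unfold tauX
  rw [mulVec_mulVec, mul_nonsing_inv _ (isUnit_iff_ne_zero.2 hdet.ne'), one_mulVec]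

lemma tauX_dot_cmb (hdet : 0 < (Gm v σ).det) (x : Fin d → ℝ) (t : Fin m → ℝ) :
    cmb v σ (tauX v σ x) ⬝ᵥ cmb v σ t = x ⬝ᵥ cmb v σ t := by
  rw [dot_cmb, dot_cmb]
  simp only [tauX_dot hdet]

lemma dot_cmb_sq_le (hdet : 0 < (Gm v σ).det) (x : Fin d → ℝ) (t : Fin m → ℝ) :
    (x ⬝ᵥ cmb v σ t) ^ 2 ≤ Qx v σ x * (cmb v σ t ⬝ᵥ cmb v σ t) := by
  rw [← tauX_dot_cmb hdet]; exact dot_sq_le _ _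

lemma coneB_meas (r : ℝ) : MeasurableSet (coneB v σ r) := by
  have : coneB v σ r = (⋂ i, {t | 0 < t i}) ∩ {t | cmb v σ t ⬝ᵥ cmb v σ t ≤ r} := by
    ext t; simp [coneB]
  rw [this]
  exact (MeasurableSet.iInter fun i => measurableSet_lt measurable_const (measurable_pi_apply i)).inter
    (measurableSet_le cmbcmb_cont.measurable measurable_const)

lemma coneB_scale (R : ℝ) (hR : 0 < R) :
    volume (coneB v σ ((R⁻¹) ^ 2)) = ENNReal.ofReal ((R⁻¹) ^ m) * volume (coneB v σ 1) := by
  have : coneB v σ ((R⁻¹) ^ 2) = R⁻¹ • coneB v σ 1 := by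
    ext t
    rw [Set.mem_inv_smul_set_iff₀ hR.ne']
    simp only [coneB, Set.mem_ofPred_eq, cmb_smul, smul_dotProduct, dotProduct_smul, Pi.smul_apply, smul_eq_mul]
    refine and_congr (forall_congr' fun i => ?_) ?_
    · constructor
      · intro h; positivity
      · intro h; exact (pos_iff_pos_of_mul_pos h).1 hR
    · rw [inv_pow, ← one_div, le_div_iff₀ (by positivity)]
      ring_nf
  rw [this, Measure.addHaar_smul]
  simp [abs_of_pos hR]

lemma main_lower (hdet : 0 < (Gm v σ).det) (R : ℝ) (hR : 1 ≤ R) (x : Fin d → ℝ) (hx : Qx v σ x ≤ R ^ 2) :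
    ENNReal.ofReal (Real.exp (-(3/2)) * (R⁻¹) ^ m) * volume (coneB v σ 1) * ENNReal.ofReal (gaussPDF d x) ≤
      ∫⁻ t in {t : Fin m → ℝ | ∀ i, 0 < t i}, ENNReal.ofReal (gaussPDF d (x + cmb v σ t)) := by
  have hR0 : 0 < R := by linarith
  calc _ = ENNReal.ofReal (Real.exp (-(3/2)) * gaussPDF d x) * volume (coneB v σ ((R⁻¹) ^ 2)) := by
        rw [coneB_scale R hR0, ENNReal.ofReal_mul (by positivity), ENNReal.ofReal_mul (by positivity)]
        ring
    _ = ∫⁻ t in coneB v σ ((R⁻¹) ^ 2), ENNReal.ofReal (Real.exp (-(3/2)) * gaussPDF d x) := by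
        rw [setLIntegral_const]
    _ ≤ ∫⁻ t in coneB v σ ((R⁻¹) ^ 2), ENNReal.ofReal (gaussPDF d (x + cmb v σ t)) := by
        refine setLIntegral_mono' (coneB_meas _) fun t ht => ?_
        apply ENNReal.ofReal_le_ofReal
        rw [gaussPDF_add, mul_comm]
        refine mul_le_mul_of_nonneg_left (Real.exp_le_exp.2 ?_) (gaussPDF_nonneg x)
        have h1 := dot_cmb_sq_le hdet x t
        have h2 : cmb v σ t ⬝ᵥ cmb v σ t ≤ (R⁻¹) ^ 2 := ht.2
        have h3 : 0 ≤ cmb v σ t ⬝ᵥ cmb v σ t := dot_self_nonneg' _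
        have h4 : Qx v σ x * (cmb v σ t ⬝ᵥ cmb v σ t) ≤ R ^ 2 * (R⁻¹) ^ 2 := by gcongr
        have h5 : R ^ 2 * (R⁻¹) ^ 2 = 1 := by field_simp
        have h6 : (R⁻¹) ^ 2 ≤ 1 := pow_le_one₀ (by positivity) (inv_le_one_of_one_le₀ hR)
        have h7 : |x ⬝ᵥ cmb v σ t| ≤ 1 := by
          apply abs_le_of_sq_le_sq _ (by norm_num); linarith
        linarith [(abs_le.1 h7).2]
    _ ≤ _ := lintegral_mono_set fun t ht => ht.1

lemma gm (d : ℕ) : Measurable (fun x : Fin d → ℝ => ENNReal.ofReal (gaussPDF d x)) :=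
  ENNReal.measurable_ofReal.comp gaussPDF_cont.measurable

lemma gWm (h : GoodG g ρ) (S : Finset (Fin d)) : Measurable (fun x => ENNReal.ofReal (gW v b g ρ S x)) :=
  ENNReal.measurable_ofReal.comp (gW_cont h S).measurable

lemma bound_main (h : GoodG g ρ) (Sg : Finset (Fin m → Fin d)) (hinj : ∀ σ ∈ Sg, Function.Injective σ)
    (hdet : ∀ σ ∈ Sg, 0 < (Gm v σ).det) (R : ℝ) (hR : 1 ≤ R) :
    ∑ σ ∈ Sg, ENNReal.ofReal (Gm v σ).det * volume (coneB v σ 1) *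
      ∫⁻ x in {x | Qx v σ x ≤ R ^ 2}, ENNReal.ofReal (gW v b g ρ (Finset.univ.image σ) x) * ENNReal.ofReal (gaussPDF d x)
      ≤ ENNReal.ofReal (Real.exp (3/2) * R ^ m) * ((m ^ m : ℕ) : ENNReal) := by
  set c := ENNReal.ofReal (Real.exp (-(3/2)) * (R⁻¹) ^ m) with hc
  have hcc : ENNReal.ofReal (Real.exp (3/2) * R ^ m) * c = 1 := by
    rw [hc, ← ENNReal.ofReal_mul (by positivity)]
    have : Real.exp (3/2) * R ^ m * (Real.exp (-(3/2)) * (R⁻¹) ^ m) = 1 := by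
      rw [show Real.exp (3/2) * R ^ m * (Real.exp (-(3/2)) * (R⁻¹) ^ m) = (Real.exp (3/2) * Real.exp (-(3/2))) * (R * R⁻¹) ^ m by
        rw [mul_pow]; ring]
      rw [← Real.exp_add, mul_inv_cancel₀ (by linarith)]; simp
    rw [this]; simp
  set X := fun σ : Fin m → Fin d => ENNReal.ofReal (Gm v σ).det * volume (coneB v σ 1) *
      ∫⁻ x in {x | Qx v σ x ≤ R ^ 2}, ENNReal.ofReal (gW v b g ρ (Finset.univ.image σ) x) * ENNReal.ofReal (gaussPDF d x)
  have key : ∀ σ ∈ Sg, c * X σ ≤ ∫⁻ y, ENNReal.ofReal (gaussPDF d y) * ∫⁻ s, (Eset v b σ y).indicator (fun s => ENNReal.ofReal (∏ j, ρ (s j))) s := by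
    intro σ hσ
    simp_rw [← E_lint (b := b) h (hinj σ hσ) (hdet σ hσ)]
    have e1 : ∀ y, ENNReal.ofReal (gaussPDF d y) * (ENNReal.ofReal (Gm v σ).det * ∫⁻ t in {t : Fin m → ℝ | ∀ i, 0 < t i},
      ENNReal.ofReal (gW v b g ρ (Finset.univ.image σ) (y - cmb v σ t))) =
      ENNReal.ofReal (Gm v σ).det * (ENNReal.ofReal (gaussPDF d y) * ∫⁻ t in {t : Fin m → ℝ | ∀ i, 0 < t i},
      ENNReal.ofReal (gW v b g ρ (Finset.univ.image σ) (y - cmb v σ t))) := fun y => by ring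
    simp_rw [e1]
    rw [lintegral_const_mul' _ _ ENNReal.ofReal_ne_top,
      tonelli (fun y => ENNReal.ofReal (gaussPDF d y)) (fun y => ENNReal.ofReal (gW v b g ρ (Finset.univ.image σ) y))
        (gm d) (gWm h _)]
    have e2 : c * X σ = ENNReal.ofReal (Gm v σ).det * ∫⁻ x in {x | Qx v σ x ≤ R ^ 2},
        ENNReal.ofReal (gW v b g ρ (Finset.univ.image σ) x) * (c * volume (coneB v σ 1) * ENNReal.ofReal (gaussPDF d x)) := by
      have : ∀ x, ENNReal.ofReal (gW v b g ρ (Finset.univ.image σ) x) * (c * volume (coneB v σ 1) * ENNReal.ofReal (gaussPDF d x)) =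
        (c * volume (coneB v σ 1)) * (ENNReal.ofReal (gW v b g ρ (Finset.univ.image σ) x) * ENNReal.ofReal (gaussPDF d x)) := fun x => by ring
      simp_rw [this]
      have hmm : Measurable fun x => ENNReal.ofReal (gW v b g ρ (Finset.univ.image σ) x) * ENNReal.ofReal (gaussPDF d x) :=
        (gWm h _).mul (gm d)
      rw [lintegral_const_mul _ hmm]
      simp only [X]; ring
    rw [e2]
    refine mul_le_mul' le_rfl ?_
    refine (setLIntegral_mono' (measurableSet_le Qx_cont.measurable measurable_const) fun x hx => ?_).trans
      (setLIntegral_le_lintegral _ _)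
    gcongr
    exact main_lower (hdet σ hσ) R hR x hx
  have hsum : c * ∑ σ ∈ Sg, X σ ≤ ((m ^ m : ℕ) : ENNReal) := by
    rw [Finset.mul_sum]
    have hm : ∀ σ ∈ Sg, Measurable (fun y => ENNReal.ofReal (gaussPDF d y) * ∫⁻ s, (Eset v b σ y).indicator (fun s => ENNReal.ofReal (∏ j, ρ (s j))) s) := by
      intro σ hσ
      simp_rw [← E_lint (b := b) h (hinj σ hσ) (hdet σ hσ)]
      refine (gm d).mul (Measurable.const_mul ?_ _)
      refine Measurable.lintegral_prod_right' (f := fun p : (Fin d → ℝ) × (Fin m → ℝ) =>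
        ENNReal.ofReal (gW v b g ρ (Finset.univ.image σ) (p.1 - cmb v σ p.2))) ?_
      exact (gWm h _).comp (measurable_fst.sub (cmb_cont.measurable.comp measurable_snd))
    calc ∑ σ ∈ Sg, c * X σ ≤ ∑ σ ∈ Sg, ∫⁻ y, ENNReal.ofReal (gaussPDF d y) * ∫⁻ s, (Eset v b σ y).indicator (fun s => ENNReal.ofReal (∏ j, ρ (s j))) s :=
          Finset.sum_le_sum key
      _ = ∫⁻ y, ∑ σ ∈ Sg, ENNReal.ofReal (gaussPDF d y) * ∫⁻ s, (Eset v b σ y).indicator (fun s => ENNReal.ofReal (∏ j, ρ (s j))) s := by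
          rw [lintegral_finsetSum _ hm]
      _ ≤ ∫⁻ y, ENNReal.ofReal (gaussPDF d y) * ((m ^ m : ℕ) : ENNReal) := by
          refine lintegral_mono fun y => ?_
          rw [← Finset.mul_sum]
          gcongr
          exact sum_E h Sg hdet y
      _ = _ := by rw [lintegral_mul_const _ (gm d), gauss_lint, one_mul]
  calc ∑ σ ∈ Sg, X σ = ENNReal.ofReal (Real.exp (3/2) * R ^ m) * (c * ∑ σ ∈ Sg, X σ) := by
        rw [← mul_assoc, hcc, one_mul]
    _ ≤ _ := by gcongr

lemma bound_tail (h : GoodG g ρ) (hdet : 0 < (Gm v σ).det) :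
    ENNReal.ofReal (Gm v σ).det * volume (coneB v σ 1) *
      ∫⁻ x, ENNReal.ofReal (∏ i, ρ (b (σ i) - x ⬝ᵥ v (σ i))) * ENNReal.ofReal (gaussPDF d x * Real.exp (Qx v σ x / 2))
      ≤ ENNReal.ofReal (Real.exp (1/2)) := by
  set F : (Fin d → ℝ) → ENNReal := fun x => ENNReal.ofReal (∏ i, ρ (b (σ i) - x ⬝ᵥ v (σ i))) with hF
  have hFm : Measurable F := ENNReal.measurable_ofReal.comp
    (continuous_finsetProd _ fun j _ => h.cont.comp (continuous_const.sub (dot_cont _))).measurable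
  have hρm : Measurable (fun s : Fin m → ℝ => ENNReal.ofReal (∏ j, ρ (s j))) :=
    ENNReal.measurable_ofReal.comp (continuous_finsetProd _ fun j _ => h.cont.comp (continuous_apply j)).measurable
  have h1 : ∀ y, ENNReal.ofReal (Gm v σ).det * ∫⁻ t in Set.univ, F (y - cmb v σ t) = 1 := by
    intro y
    rw [← rho_tot h m, ← cov_lint (Gm v σ) hdet (fun i => b (σ i) - y ⬝ᵥ v (σ i)) _ hρm, Measure.restrict_univ]
    congr 1
    refine lintegral_congr fun t => ?_
    simp only [hF]
    congr 1
    refine Finset.prod_congr rfl fun i _ => ?_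
    rw [sub_dotProduct, cmb_dot]
    simp only [Pi.add_apply]
    congr 1; ring
  have h2 : ENNReal.ofReal (Gm v σ).det * ∫⁻ x, F x * ∫⁻ t in Set.univ, ENNReal.ofReal (gaussPDF d (x + cmb v σ t)) = 1 := by
    rw [← tonelli (fun x => ENNReal.ofReal (gaussPDF d x)) F (gm d) hFm, ← lintegral_const_mul' _ _ ENNReal.ofReal_ne_top,
      ← gauss_lint d]
    refine lintegral_congr fun y => ?_
    rw [mul_left_comm, h1, mul_one]
  have h3 : ∀ x, ENNReal.ofReal (Real.exp (-(1/2))) * volume (coneB v σ 1) * ENNReal.ofReal (gaussPDF d x * Real.exp (Qx v σ x / 2)) ≤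
      ∫⁻ t in Set.univ, ENNReal.ofReal (gaussPDF d (x + cmb v σ t)) := by
    intro x
    have e : ∀ t, gaussPDF d (x + cmb v σ t) = (gaussPDF d x * Real.exp (Qx v σ x / 2)) *
        Real.exp (-(cmb v σ (t + tauX v σ x) ⬝ᵥ cmb v σ (t + tauX v σ x)) / 2) := by
      intro t
      rw [gaussPDF_add, mul_assoc, ← Real.exp_add]
      congr 2
      rw [cmb_add, Qx]
      simp only [add_dotProduct, dotProduct_add]
      rw [dotProduct_comm (cmb v σ t) (cmb v σ (tauX v σ x)), tauX_dot_cmb hdet x t]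
      ring
    simp_rw [e]
    rw [Measure.restrict_univ]
    have hφ0 : 0 ≤ gaussPDF d x * Real.exp (Qx v σ x / 2) := mul_nonneg (gaussPDF_nonneg x) (Real.exp_pos _).le
    simp_rw [ENNReal.ofReal_mul hφ0]
    rw [lintegral_const_mul' _ _ (by finiteness),
      lintegral_add_right_eq_self (fun t => ENNReal.ofReal (Real.exp (-(cmb v σ t ⬝ᵥ cmb v σ t) / 2))) (tauX v σ x), mul_comm]
    gcongr
    rw [← setLIntegral_const]
    refine (setLIntegral_mono' (coneB_meas 1) fun t ht => ?_).trans (setLIntegral_le_lintegral _ _)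
    apply ENNReal.ofReal_le_ofReal
    apply Real.exp_le_exp.2
    have := ht.2
    linarith
  have hee : ENNReal.ofReal (Real.exp (1/2)) * ENNReal.ofReal (Real.exp (-(1/2))) = 1 := by
    rw [← ENNReal.ofReal_mul (by positivity), ← Real.exp_add]; simp
  have hm4 : Measurable fun x => F x * ENNReal.ofReal (gaussPDF d x * Real.exp (Qx v σ x / 2)) := by
    refine hFm.mul (ENNReal.measurable_ofReal.comp (Continuous.measurable ?_))
    exact gaussPDF_cont.mul (Real.continuous_exp.comp (Qx_cont.div_const 2))
  have h4 : ENNReal.ofReal (Real.exp (-(1/2))) * (ENNReal.ofReal (Gm v σ).det * volume (coneB v σ 1) *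
      ∫⁻ x, F x * ENNReal.ofReal (gaussPDF d x * Real.exp (Qx v σ x / 2))) ≤ 1 := by
    rw [← h2]
    calc _ = ENNReal.ofReal (Gm v σ).det * ∫⁻ x, (ENNReal.ofReal (Real.exp (-(1/2))) * volume (coneB v σ 1)) *
          (F x * ENNReal.ofReal (gaussPDF d x * Real.exp (Qx v σ x / 2))) := by
          rw [lintegral_const_mul _ hm4]; ring
      _ ≤ _ := by
          refine mul_le_mul' le_rfl (lintegral_mono fun x => ?_)
          rw [mul_left_comm]
          exact mul_le_mul' le_rfl (h3 x)
  calc _ = ENNReal.ofReal (Real.exp (1/2)) * (ENNReal.ofReal (Real.exp (-(1/2))) * (ENNReal.ofReal (Gm v σ).det * volume (coneB v σ 1) *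
      ∫⁻ x, F x * ENNReal.ofReal (gaussPDF d x * Real.exp (Qx v σ x / 2)))) := by
        rw [← mul_assoc (ENNReal.ofReal (Real.exp (1/2))), hee, one_mul]
    _ ≤ ENNReal.ofReal (Real.exp (1/2)) * 1 := by gcongr
    _ = _ := mul_one _

end bounds

end ptwise

open MeasureTheory Matrix Real

section bfin
variable {d m : ℕ} {v : Fin d → (Fin d → ℝ)} {b : Fin d → ℝ} {g ρ : ℝ → ℝ} {σ : Fin m → Fin d}

lemma one_split (h : GoodG g ρ) (hinj : Function.Injective σ) (R K : ℝ) (ψ : (Fin d → ℝ) → ℝ)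
    (hK : ∀ x, Qx v σ x ≤ R ^ 2 → |ψ x| ≤ K) (hT : ∀ x, |ψ x| ≤ 4 * Real.exp (Qx v σ x / 4)) :
    ENNReal.ofReal |∫ x, gW v b g ρ (Finset.univ.image σ) x * (ψ x * gaussPDF d x)| ≤
      ENNReal.ofReal K * (∫⁻ x in {x | Qx v σ x ≤ R ^ 2}, ENNReal.ofReal (gW v b g ρ (Finset.univ.image σ) x) * ENNReal.ofReal (gaussPDF d x))
      + ENNReal.ofReal (4 * Real.exp (-R ^ 2 / 4)) *
        ∫⁻ x, ENNReal.ofReal (∏ i, ρ (b (σ i) - x ⬝ᵥ v (σ i))) * ENNReal.ofReal (gaussPDF d x * Real.exp (Qx v σ x / 2)) := by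
  rw [← Real.enorm_eq_ofReal_abs]
  refine (enorm_integral_le_lintegral_enorm _).trans ?_
  have hms : MeasurableSet {x | Qx v σ x ≤ R ^ 2} := measurableSet_le Qx_cont.measurable measurable_const
  rw [← lintegral_add_compl _ hms]
  have hmm : Measurable fun x => ENNReal.ofReal (gW v b g ρ (Finset.univ.image σ) x) * ENNReal.ofReal (gaussPDF d x) :=
        (gWm h _).mul (gm d)
  refine add_le_add ?_ ?_
  · rw [← lintegral_const_mul _ hmm]
    refine setLIntegral_mono' hms fun x hx => ?_
    rw [Real.enorm_eq_ofReal_abs, abs_mul, abs_mul, abs_of_nonneg (gW_nonneg h _ x), abs_of_nonneg (gaussPDF_nonneg x),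
      ENNReal.ofReal_mul (gW_nonneg h _ x), ENNReal.ofReal_mul (abs_nonneg _), mul_left_comm]
    gcongr
    exact hK x hx
  · rw [← lintegral_const_mul' _ _ ENNReal.ofReal_ne_top]
    refine (setLIntegral_mono' hms.compl fun x hx => ?_).trans (setLIntegral_le_lintegral _ _)
    have hρ0 : 0 ≤ ∏ i, ρ (b (σ i) - x ⬝ᵥ v (σ i)) := Finset.prod_nonneg fun _ _ => h.nonneg _
    rw [Real.enorm_eq_ofReal_abs, abs_mul, abs_mul, abs_of_nonneg (gW_nonneg h _ x), abs_of_nonneg (gaussPDF_nonneg x),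
      ← ENNReal.ofReal_mul hρ0, ← ENNReal.ofReal_mul (by positivity)]
    apply ENNReal.ofReal_le_ofReal
    have h1 := gW_le (v := v) (b := b) h (Finset.univ.image σ) x
    rw [Finset.prod_image (fun a _ c _ hac => hinj hac)] at h1
    have hx' : R ^ 2 < Qx v σ x := by simpa using hx
    have h2 : Real.exp (Qx v σ x / 4) ≤ Real.exp (-R ^ 2 / 4) * Real.exp (Qx v σ x / 2) := by
      rw [← Real.exp_add]; apply Real.exp_le_exp.2; linarith
    calc _ ≤ (∏ i, ρ (b (σ i) - x ⬝ᵥ v (σ i))) * (4 * (Real.exp (-R ^ 2 / 4) * Real.exp (Qx v σ x / 2)) * gaussPDF d x) := by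
          have := gaussPDF_nonneg x
          have := (hT x).trans (mul_le_mul_of_nonneg_left h2 (by norm_num : (0:ℝ) ≤ 4))
          gcongr
      _ = _ := by ring

lemma Bfin (h : GoodG g ρ) (Sg : Finset (Fin m → Fin d)) (hinj : ∀ σ ∈ Sg, Function.Injective σ)
    (hdet : ∀ σ ∈ Sg, 0 < (Gm v σ).det) (R : ℝ) (hR : 1 ≤ R) (K : ℝ) (hK0 : 0 ≤ K)
    (ψ : (Fin m → Fin d) → (Fin d → ℝ) → ℝ)
    (hK : ∀ σ ∈ Sg, ∀ x, Qx v σ x ≤ R ^ 2 → |ψ σ x| ≤ K)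
    (hT : ∀ σ ∈ Sg, ∀ x, |ψ σ x| ≤ 4 * Real.exp (Qx v σ x / 4))
    (w : (Fin m → Fin d) → ℝ) (hw0 : ∀ σ ∈ Sg, 0 ≤ w σ) (D : ℝ) (hD : 0 ≤ D)
    (hw : ∀ σ ∈ Sg, ENNReal.ofReal (w σ) ≤ ENNReal.ofReal D * (ENNReal.ofReal (Gm v σ).det * volume (coneB v σ 1))) :
    ∑ σ ∈ Sg, w σ * |∫ x, gW v b g ρ (Finset.univ.image σ) x * (ψ σ x * gaussPDF d x)| ≤
      D * (K * (Real.exp (3/2) * R ^ m * (m ^ m : ℕ)) + 4 * Real.exp (-R ^ 2 / 4) * (Real.exp (1/2) * (d ^ m : ℕ))) := by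
  rw [← ENNReal.ofReal_le_ofReal_iff (by positivity), ENNReal.ofReal_sum_of_nonneg fun σ hσ => mul_nonneg (hw0 σ hσ) (abs_nonneg _)]
  set X := fun σ : Fin m → Fin d => ∫⁻ x in {x | Qx v σ x ≤ R ^ 2}, ENNReal.ofReal (gW v b g ρ (Finset.univ.image σ) x) * ENNReal.ofReal (gaussPDF d x) with hX
  set Y := fun σ : Fin m → Fin d => ∫⁻ x, ENNReal.ofReal (∏ i, ρ (b (σ i) - x ⬝ᵥ v (σ i))) * ENNReal.ofReal (gaussPDF d x * Real.exp (Qx v σ x / 2)) with hY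
  have step : ∀ σ ∈ Sg, ENNReal.ofReal (w σ * |∫ x, gW v b g ρ (Finset.univ.image σ) x * (ψ σ x * gaussPDF d x)|) ≤
      ENNReal.ofReal D * (ENNReal.ofReal K * (ENNReal.ofReal (Gm v σ).det * volume (coneB v σ 1) * X σ)
        + ENNReal.ofReal (4 * Real.exp (-R ^ 2 / 4)) * (ENNReal.ofReal (Gm v σ).det * volume (coneB v σ 1) * Y σ)) := by
    intro σ hσ
    rw [ENNReal.ofReal_mul (hw0 σ hσ)]
    refine (mul_le_mul' (hw σ hσ) (one_split h (hinj σ hσ) R K (ψ σ) (hK σ hσ) (hT σ hσ))).trans (le_of_eq ?_)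
    simp only [hX, hY]; ring
  refine (Finset.sum_le_sum step).trans ?_
  rw [← Finset.mul_sum, Finset.sum_add_distrib, ← Finset.mul_sum, ← Finset.mul_sum, ENNReal.ofReal_mul hD,
    ENNReal.ofReal_add (by positivity) (by positivity), ENNReal.ofReal_mul hK0, ENNReal.ofReal_mul (by positivity : (0:ℝ) ≤ 4 * Real.exp (-R ^ 2 / 4))]
  have h1 := bound_main (b := b) h Sg hinj hdet R hR
  have h2 : ∑ σ ∈ Sg, ENNReal.ofReal (Gm v σ).det * volume (coneB v σ 1) * Y σ ≤ ENNReal.ofReal (Real.exp (1/2) * (d ^ m : ℕ)) := by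
    calc _ ≤ ∑ σ ∈ Sg, ENNReal.ofReal (Real.exp (1/2)) := Finset.sum_le_sum fun σ hσ => bound_tail h (hdet σ hσ)
      _ = (Sg.card : ENNReal) * ENNReal.ofReal (Real.exp (1/2)) := by rw [Finset.sum_const, nsmul_eq_mul]
      _ ≤ ((d ^ m : ℕ) : ENNReal) * ENNReal.ofReal (Real.exp (1/2)) := by
          gcongr
          refine (Finset.card_le_univ _).trans ?_
          simp
      _ = _ := by
          rw [ENNReal.ofReal_mul (by positivity), ENNReal.ofReal_natCast, mul_comm]
  have h1' : ENNReal.ofReal (Real.exp (3/2) * R ^ m) * ((m ^ m : ℕ) : ENNReal) = ENNReal.ofReal (Real.exp (3/2) * R ^ m * (m ^ m : ℕ)) := by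
    rw [ENNReal.ofReal_mul (p := Real.exp (3/2) * R ^ m) (by positivity), ENNReal.ofReal_natCast]
  rw [h1'] at h1
  gcongr

end bfin

open MeasureTheory Matrix Real

/-- sine of the angle -/
noncomputable def sN {d : ℕ} (v w : Fin d → ℝ) : ℝ := Real.sqrt (∑ i, (w i - (v ⬝ᵥ w) * v i) ^ 2)

/-- distance to the plane -/
noncomputable def nN {d : ℕ} (v w u : Fin d → ℝ) : ℝ := Real.sqrt (∑ i,
      (u i - (v ⬝ᵥ u) * v i - (perpUnit v w ⬝ᵥ u) * perpUnit v w i) ^ 2)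

section geom
variable {d : ℕ} {v w u : Fin d → ℝ}

lemma perp_eq : perpUnit v w = (sN v w)⁻¹ • (w - (v ⬝ᵥ w) • v) := rfl

lemma perp2_eq : perpUnit2 v w u = (nN v w u)⁻¹ • (u - (v ⬝ᵥ u) • v - (perpUnit v w ⬝ᵥ u) • perpUnit v w) := rfl

lemma sN_sq (hv : v ⬝ᵥ v = 1) (hw : w ⬝ᵥ w = 1) : sN v w ^ 2 = 1 - (v ⬝ᵥ w) ^ 2 := by
  unfold sN
  rw [Real.sq_sqrt (by positivity)]
  have : ∑ i, (w i - (v ⬝ᵥ w) * v i) ^ 2 = (w - (v ⬝ᵥ w) • v) ⬝ᵥ (w - (v ⬝ᵥ w) • v) := by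
    rw [← sum_sq_eq_dot]; rfl
  rw [this]
  simp only [sub_dotProduct, dotProduct_sub, smul_dotProduct, dotProduct_smul, smul_eq_mul, hv, hw, dotProduct_comm w v]
  ring

lemma sN_eq (hv : v ⬝ᵥ v = 1) (hw : w ⬝ᵥ w = 1) : sN v w = Real.sqrt (1 - (v ⬝ᵥ w) ^ 2) := by
  rw [← sN_sq hv hw, Real.sqrt_sq (show 0 ≤ sN v w from Real.sqrt_nonneg _)]

lemma perp_dot (hv : v ⬝ᵥ v = 1) : perpUnit v w ⬝ᵥ v = 0 := by
  rw [perp_eq]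
  simp [sub_dotProduct, smul_dotProduct, hv, dotProduct_comm w v]

lemma s_perp (hs : 0 < sN v w) : sN v w • perpUnit v w = w - (v ⬝ᵥ w) • v := by
  rw [perp_eq, smul_smul, mul_inv_cancel₀ hs.ne', one_smul]

lemma perp_unit (hv : v ⬝ᵥ v = 1) (hw : w ⬝ᵥ w = 1) (hs : 0 < sN v w) : perpUnit v w ⬝ᵥ perpUnit v w = 1 := by
  have h1 : sN v w ^ 2 * (perpUnit v w ⬝ᵥ perpUnit v w) = sN v w ^ 2 := by
    calc _ = (sN v w • perpUnit v w) ⬝ᵥ (sN v w • perpUnit v w) := by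
          simp [smul_dotProduct, dotProduct_smul]; ring
      _ = _ := by
          rw [s_perp hs, sN_sq hv hw]
          simp only [sub_dotProduct, dotProduct_sub, smul_dotProduct, dotProduct_smul, smul_eq_mul, hv, hw, dotProduct_comm w v]
          ring
  have : sN v w ^ 2 ≠ 0 := by positivity
  exact mul_left_cancel₀ this (by rw [h1, mul_one])

lemma nN_sq (hv : v ⬝ᵥ v = 1) (hw : w ⬝ᵥ w = 1) (hu : u ⬝ᵥ u = 1) (hs : 0 < sN v w) :
    nN v w u ^ 2 = 1 - ((v ⬝ᵥ u) ^ 2 + (perpUnit v w ⬝ᵥ u) ^ 2) := by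
  unfold nN
  rw [Real.sq_sqrt (by positivity)]
  have : ∑ i, (u i - (v ⬝ᵥ u) * v i - (perpUnit v w ⬝ᵥ u) * perpUnit v w i) ^ 2 =
      (u - (v ⬝ᵥ u) • v - (perpUnit v w ⬝ᵥ u) • perpUnit v w) ⬝ᵥ (u - (v ⬝ᵥ u) • v - (perpUnit v w ⬝ᵥ u) • perpUnit v w) := by
    rw [← sum_sq_eq_dot]; rfl
  rw [this]
  have h1 := perp_dot (w := w) hv
  have h2 := perp_unit hv hw hs
  have h3 : v ⬝ᵥ perpUnit v w = 0 := by rw [dotProduct_comm]; exact h1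
  simp only [sub_dotProduct, dotProduct_sub, smul_dotProduct, dotProduct_smul, smul_eq_mul, hv, hu, h1, h2, h3,
    dotProduct_comm u v, dotProduct_comm u (perpUnit v w)]
  ring

lemma n_perp2 (hn : 0 < nN v w u) :
    nN v w u • perpUnit2 v w u = u - (v ⬝ᵥ u) • v - (perpUnit v w ⬝ᵥ u) • perpUnit v w := by
  rw [perp2_eq, smul_smul, mul_inv_cancel₀ hn.ne', one_smul]

lemma s_perp_dot (hs : 0 < sN v w) (x : Fin d → ℝ) :
    sN v w * (perpUnit v w ⬝ᵥ x) = w ⬝ᵥ x - (v ⬝ᵥ w) * (v ⬝ᵥ x) := by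
  rw [← smul_eq_mul, ← smul_dotProduct, s_perp hs]
  simp [sub_dotProduct, smul_dotProduct]

lemma n_perp2_dot (hn : 0 < nN v w u) (x : Fin d → ℝ) :
    nN v w u * (perpUnit2 v w u ⬝ᵥ x) = u ⬝ᵥ x - (v ⬝ᵥ u) * (v ⬝ᵥ x) - (perpUnit v w ⬝ᵥ u) * (perpUnit v w ⬝ᵥ x) := by
  rw [← smul_eq_mul, ← smul_dotProduct, n_perp2 hn]
  simp [sub_dotProduct, smul_dotProduct]

/-- Gram determinant -/
lemma gram3 (hv : v ⬝ᵥ v = 1) (hw : w ⬝ᵥ w = 1) (hu : u ⬝ᵥ u = 1) (hs : 0 < sN v w) :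
    (sN v w * nN v w u) ^ 2 = 1 + 2 * (v ⬝ᵥ w) * (v ⬝ᵥ u) * (w ⬝ᵥ u) - (v ⬝ᵥ w) ^ 2 - (v ⬝ᵥ u) ^ 2 - (w ⬝ᵥ u) ^ 2 := by
  have h1 := s_perp_dot hs u
  have h2 := sN_sq hv hw
  rw [mul_pow, nN_sq hv hw hu hs]
  have h3 : sN v w ^ 2 * (perpUnit v w ⬝ᵥ u) ^ 2 = (w ⬝ᵥ u - (v ⬝ᵥ w) * (v ⬝ᵥ u)) ^ 2 := by rw [← h1]; ring
  calc _ = sN v w ^ 2 * (1 - (v ⬝ᵥ u) ^ 2) - sN v w ^ 2 * (perpUnit v w ⬝ᵥ u) ^ 2 := by ring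
    _ = _ := by rw [h3, h2]; ring

lemma sN_lower (hv : v ⬝ᵥ v = 1) (hw : w ⬝ᵥ w = 1) (α : ℝ) (hα : α ≤ Real.arccos (v ⬝ᵥ w)) 
    (hc : -(1/2) ≤ v ⬝ᵥ w) : α / 8 ≤ sN v w := by
  rw [sN_eq hv hw]
  rcases le_or_gt 0 (v ⬝ᵥ w) with h | h
  · rw [← Real.sin_arccos]
    have h1 := Real.mul_le_sin (Real.arccos_nonneg (v ⬝ᵥ w)) (Real.arccos_le_pi_div_two.2 h)
    have h2 : (1:ℝ)/8 ≤ 2 / π := by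
      rw [le_div_iff₀ Real.pi_pos]; linarith [Real.pi_le_four]
    have h3 := mul_le_mul_of_nonneg_right h2 (Real.arccos_nonneg (v ⬝ᵥ w))
    linarith
  · have h1 : α ≤ 4 := hα.trans ((Real.arccos_le_pi _).trans Real.pi_le_four)
    have : (1:ℝ)/2 ≤ Real.sqrt (1 - (v ⬝ᵥ w) ^ 2) := by
      apply Real.le_sqrt_of_sq_le; nlinarith
    linarith

lemma nN_lower (hv : v ⬝ᵥ v = 1) (hw : w ⬝ᵥ w = 1) (hu : u ⬝ᵥ u = 1) (hs : 0 < sN v w) (β : ℝ)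
    (hβ : β ≤ Real.arccos (Real.sqrt ((v ⬝ᵥ u) ^ 2 + (perpUnit v w ⬝ᵥ u) ^ 2))) : β / 2 ≤ nN v w u := by
  have e : nN v w u = Real.sin (Real.arccos (Real.sqrt ((v ⬝ᵥ u) ^ 2 + (perpUnit v w ⬝ᵥ u) ^ 2))) := by
    rw [Real.sin_arccos, Real.sq_sqrt (by positivity), ← nN_sq hv hw hu hs, Real.sqrt_sq (show 0 ≤ nN v w u from Real.sqrt_nonneg _)]
  rw [e]
  set y := Real.sqrt ((v ⬝ᵥ u) ^ 2 + (perpUnit v w ⬝ᵥ u) ^ 2)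
  have h1 := Real.mul_le_sin (Real.arccos_nonneg y) (Real.arccos_le_pi_div_two.2 (Real.sqrt_nonneg _))
  have h2 : (1:ℝ)/2 ≤ 2 / π := by
    rw [le_div_iff₀ Real.pi_pos]; linarith [Real.pi_le_four]
  have h3 := mul_le_mul_of_nonneg_right h2 (Real.arccos_nonneg y)
  linarith

end geom

section kappa
variable {d m : ℕ} {v : Fin d → (Fin d → ℝ)} {σ : Fin m → Fin d}

lemma dot_le_one {x y : Fin d → ℝ} (hx : x ⬝ᵥ x = 1) (hy : y ⬝ᵥ y = 1) : x ⬝ᵥ y ≤ 1 := by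
  have := dot_sq_le x y
  rw [hx, hy] at this
  nlinarith

lemma kappa_box (hu : ∀ j, v j ⬝ᵥ v j = 1) : ENNReal.ofReal ((1 / (m:ℝ)) ^ m) ≤ volume (coneB v σ 1) := by
  have hb : volume (Set.pi Set.univ fun _ : Fin m => Set.Ioc (0:ℝ) (1/(m:ℝ))) = ENNReal.ofReal ((1 / (m:ℝ)) ^ m) := by
    rw [Real.volume_pi_Ioc]
    rw [ENNReal.ofReal_pow (by positivity)]
    simp
  rw [← hb]
  apply measure_mono
  intro t ht
  have h0 : ∀ i, 0 < t i := fun i => (ht i (Set.mem_univ i)).1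
  have h1 : ∀ i, t i ≤ 1 / (m:ℝ) := fun i => (ht i (Set.mem_univ i)).2
  refine ⟨h0, ?_⟩
  have hs : ∑ i, t i ≤ 1 := by
    calc _ ≤ ∑ i : Fin m, 1 / (m:ℝ) := Finset.sum_le_sum fun i _ => h1 i
      _ ≤ 1 := by
        rw [Finset.sum_const]; simp only [Finset.card_univ, Fintype.card_fin, nsmul_eq_mul, one_div]
        exact mul_inv_le_one
  calc cmb v σ t ⬝ᵥ cmb v σ t = ∑ i, t i * ∑ k, t k * (v (σ i) ⬝ᵥ v (σ k)) := by
        rw [dot_cmb]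
        refine Finset.sum_congr rfl fun i _ => ?_
        rw [dotProduct_comm, dot_cmb]
    _ ≤ ∑ i, t i * ∑ k, t k * 1 := by
        refine Finset.sum_le_sum fun i _ => mul_le_mul_of_nonneg_left (Finset.sum_le_sum fun k _ => ?_) (h0 i).le
        exact mul_le_mul_of_nonneg_left (dot_le_one (hu _) (hu _)) (h0 k).le
    _ = (∑ i, t i) ^ 2 := by simp only [mul_one]; rw [← Finset.sum_mul, sq]
    _ ≤ 1 := pow_le_one₀ (Finset.sum_nonneg fun i _ => (h0 i).le) hs

lemma kappa_obt (hu : ∀ j, v j ⬝ᵥ v j = 1) (j k : Fin d) (hs : 0 < sN (v j) (v k)) (hc : v j ⬝ᵥ v k ≤ 0) :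
    ENNReal.ofReal (1/4) ≤ ENNReal.ofReal (sN (v j) (v k)) * volume (coneB v ![j, k] 1) := by
  set s := sN (v j) (v k)
  set c := v j ⬝ᵥ v k with hcdef
  have hsq : s ^ 2 = 1 - c ^ 2 := sN_sq (hu j) (hu k)
  set M : Matrix (Fin 2) (Fin 2) ℝ := !![1, c; 0, s]
  have hM : M.det = s := by simp [M, Matrix.det_fin_two]
  set B : Set (Fin 2 → ℝ) := Set.pi Set.univ fun _ => Set.Ioc (0:ℝ) (1/2)
  have hBm : MeasurableSet B := MeasurableSet.univ_pi fun _ => measurableSet_Ioc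
  have hb : volume B = ENNReal.ofReal (1/4) := by
    simp only [B]
    rw [Real.volume_pi_Ioc, Fin.prod_univ_two, ← ENNReal.ofReal_mul (by norm_num)]
    norm_num
  have h1 := cov_lint M (by rw [hM]; exact hs) 0 (B.indicator 1) (measurable_one.indicator hBm)
  rw [lintegral_indicator_one hBm, hb, hM] at h1
  rw [← h1, ← lintegral_indicator_one (coneB_meas 1)]
  refine mul_le_mul' le_rfl (lintegral_mono fun t => ?_)
  by_cases ht : M *ᵥ t + 0 ∈ B
  · have a0 := ht 0 (Set.mem_univ _)
    have a1 := ht 1 (Set.mem_univ _)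
    simp [M, dotProduct, Fin.sum_univ_two] at a0 a1
    have t1 : 0 < t 1 := by
      by_contra hcon
      have := mul_nonneg hs.le (by linarith : 0 ≤ - t 1)
      linarith [a1.1]
    have t0 : 0 < t 0 := by nlinarith [a0.1]
    have hmem : t ∈ coneB v ![j, k] 1 := by
      refine ⟨fun i => ?_, ?_⟩
      · fin_cases i
        · exact t0
        · exact t1
      · have : cmb v ![j, k] t ⬝ᵥ cmb v ![j, k] t = (t 0 + c * t 1) ^ 2 + (s * t 1) ^ 2 := by
          simp only [cmb, Fin.sum_univ_two, Matrix.cons_val_zero, Matrix.cons_val_one, add_dotProduct, dotProduct_add,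
            smul_dotProduct, dotProduct_smul, smul_eq_mul, hu, dotProduct_comm (v k) (v j), ← hcdef]
          rw [mul_pow s, hsq]; ring
        rw [this]
        nlinarith [a0.1, a0.2, a1.1, a1.2]
    rw [Set.indicator_of_mem ht, Set.indicator_of_mem hmem]
    simp
  · rw [Set.indicator_of_notMem ht]; exact zero_le

lemma det2 (hu : ∀ j, v j ⬝ᵥ v j = 1) (j k : Fin d) : (Gm v ![j, k]).det = sN (v j) (v k) ^ 2 := by
  rw [sN_sq (hu j) (hu k), Matrix.det_fin_two]
  simp [Gm, hu, dotProduct_comm (v k) (v j)]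
  ring

lemma det3 (hu : ∀ j, v j ⬝ᵥ v j = 1) (j k l : Fin d) (hs : 0 < sN (v j) (v k)) :
    (Gm v ![j, k, l]).det = (sN (v j) (v k) * nN (v j) (v k) (v l)) ^ 2 := by
  rw [gram3 (hu j) (hu k) (hu l) hs, Matrix.det_fin_three]
  simp [Gm, hu, dotProduct_comm (v k) (v j), dotProduct_comm (v l) (v j), dotProduct_comm (v l) (v k)]
  ring

lemma det1 (hu : ∀ j, v j ⬝ᵥ v j = 1) (j : Fin d) : (Gm v ![j]).det = 1 := by
  simp [Gm, hu]

/-- geometric hypotheses in usable form -/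
structure Geo {d : ℕ} (v : Fin d → (Fin d → ℝ)) (α β : ℝ) : Prop where
  hu : ∀ j, v j ⬝ᵥ v j = 1
  ha : 0 < α
  hb : 0 < β
  a4 : α ≤ 4
  b4 : β ≤ 4
  hα : ∀ j k : Fin d, j ≠ k → α ≤ Real.arccos (v j ⬝ᵥ v k)
  hs : ∀ j k : Fin d, j ≠ k → 0 < sN (v j) (v k)
  hanti : ∀ j k : Fin d, j ≠ k → v k ≠ -v j
  hn : ∀ j k l : Fin d, j ≠ k → k ≠ l → j ≠ l → β / 2 ≤ nN (v j) (v k) (v l)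

lemma Geo.hn0 {α β : ℝ} (G : Geo v α β) (j k l : Fin d) (h1 : j ≠ k) (h2 : k ≠ l) (h3 : j ≠ l) : 0 < nN (v j) (v k) (v l) := by
  have := G.hn j k l h1 h2 h3
  have := G.hb
  linarith

lemma geo_of (hd : 3 ≤ d) (hu : ∀ j, ∑ i, v j i ^ 2 = 1) (α β : ℝ) (ha : 0 < α) (hb : 0 < β)
    (hα : ∀ j k : Fin d, j ≠ k → α ≤ Real.arccos (v j ⬝ᵥ v k))
    (hβ : ∀ j k l : Fin d, j ≠ k → k ≠ l → j ≠ l → v k ≠ -v j →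
          β ≤ Real.arccos (Real.sqrt
            ((v j ⬝ᵥ v l) ^ 2 + (perpUnit (v j) (v k) ⬝ᵥ v l) ^ 2))) : Geo v α β := by
  have hu' : ∀ j, v j ⬝ᵥ v j = 1 := fun j => by rw [← sum_sq_eq_dot]; exact hu j
  have hlt1 : ∀ j k : Fin d, j ≠ k → v j ⬝ᵥ v k < 1 := by
    intro j k hjk
    have := ha.trans_le (hα j k hjk)
    exact Real.arccos_pos.1 this
  have third : ∀ j k : Fin d, ∃ l, l ≠ j ∧ l ≠ k := by
    intro j k
    have : ∃ l, l ∉ ({j, k} : Finset (Fin d)) := by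
      by_contra hcon
      push Not at hcon
      have h1 : (Finset.univ : Finset (Fin d)) ⊆ {j, k} := fun l _ => hcon l
      have h2 := Finset.card_le_card h1
      have h3 := Finset.card_le_two (a := j) (b := k)
      simp at h2; omega
    obtain ⟨l, hl⟩ := this
    simp at hl
    exact ⟨l, hl.1, hl.2⟩
  have hanti : ∀ j k : Fin d, j ≠ k → v k ≠ -v j := by
    intro j k hjk hk
    obtain ⟨l, hlj, hlk⟩ := third j k
    have hlj' : v l ≠ -v j := by
      intro hl
      have h1 := hlt1 l k hlk
      rw [hl, ← hk, hu'] at h1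
      exact lt_irrefl _ h1
    have h1 := hβ j l k hlj.symm hlk hjk hlj'
    have h2 : (1:ℝ) ≤ Real.sqrt ((v j ⬝ᵥ v k) ^ 2 + (perpUnit (v j) (v l) ⬝ᵥ v k) ^ 2) := by
      apply Real.le_sqrt_of_sq_le
      have : v j ⬝ᵥ v k = -1 := by rw [hk, dotProduct_neg, hu']
      rw [this]; nlinarith [sq_nonneg (perpUnit (v j) (v l) ⬝ᵥ v k)]
    rw [Real.arccos_eq_zero.2 h2] at h1
    linarith
  have hs : ∀ j k : Fin d, j ≠ k → 0 < sN (v j) (v k) := by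
    intro j k hjk
    rw [sN_eq (hu' j) (hu' k)]
    apply Real.sqrt_pos.2
    have h1 := hlt1 j k hjk
    have h2 : -1 < v j ⬝ᵥ v k := by
      by_contra hcon
      have hz : (v k + v j) ⬝ᵥ (v k + v j) ≤ 0 := by
        simp only [add_dotProduct, dotProduct_add, hu', dotProduct_comm (v k) (v j)]
        linarith
      have hz' := dot_self_nonpos hz
      exact hanti j k hjk (eq_neg_of_add_eq_zero_left hz')
    nlinarith
  have hn : ∀ j k l : Fin d, j ≠ k → k ≠ l → j ≠ l → β / 2 ≤ nN (v j) (v k) (v l) :=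
    fun j k l h1 h2 h3 => nN_lower (hu' j) (hu' k) (hu' l) (hs j k h1) β (hβ j k l h1 h2 h3 (hanti j k h1))
  refine ⟨hu', ha, hb, ?_, ?_, hα, hs, hanti, hn⟩
  · have : (⟨0, by omega⟩ : Fin d) ≠ ⟨1, by omega⟩ := by simp
    exact (hα _ _ this).trans ((Real.arccos_le_pi _).trans Real.pi_le_four)
  · have h1 : (⟨0, by omega⟩ : Fin d) ≠ ⟨1, by omega⟩ := by simp
    have h2 : (⟨1, by omega⟩ : Fin d) ≠ ⟨2, by omega⟩ := by simp
    have h3 : (⟨0, by omega⟩ : Fin d) ≠ ⟨2, by omega⟩ := by simp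
    exact (hβ _ _ _ h1 h2 h3 (hanti _ _ h1)).trans ((Real.arccos_le_pi _).trans Real.pi_le_four)

variable {α β : ℝ}

lemma wt1 (G : Geo v α β) (j : Fin d) :
    ENNReal.ofReal 1 ≤ ENNReal.ofReal 1 * (ENNReal.ofReal (Gm v ![j]).det * volume (coneB v ![j] 1)) := by
  rw [det1 G.hu]
  have := kappa_box (m := 1) (σ := ![j]) G.hu
  simpa using this

lemma wt2 (G : Geo v α β) (j k : Fin d) (hjk : j ≠ k) :
    ENNReal.ofReal (sN (v j) (v k)) ≤ ENNReal.ofReal (32 / α) * (ENNReal.ofReal (Gm v ![j, k]).det * volume (coneB v ![j, k] 1)) := by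
  have hs := G.hs j k hjk
  have ha := G.ha
  rw [det2 G.hu]
  rcases le_or_gt 0 (v j ⬝ᵥ v k) with h | h
  · have h1 := kappa_box (m := 2) (σ := ![j, k]) G.hu
    have h2 := sN_lower (G.hu j) (G.hu k) α (G.hα j k hjk) (by linarith)
    calc _ ≤ ENNReal.ofReal (32 / α) * (ENNReal.ofReal (sN (v j) (v k) ^ 2) * ENNReal.ofReal ((1 / ((2:ℕ):ℝ)) ^ 2)) := by
          rw [← ENNReal.ofReal_mul (by positivity), ← ENNReal.ofReal_mul (by positivity)]
          apply ENNReal.ofReal_le_ofReal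
          have : 32 / α * (sN (v j) (v k) ^ 2 * (1 / ((2:ℕ):ℝ)) ^ 2) = sN (v j) (v k) * (8 * sN (v j) (v k) / α) := by
            push_cast; ring
          rw [this]
          apply le_mul_of_one_le_right hs.le
          rw [le_div_iff₀ ha]; linarith
      _ ≤ _ := by gcongr
  · have h1 := kappa_obt G.hu j k hs h.le
    calc _ ≤ ENNReal.ofReal (32 / α * sN (v j) (v k)) * ENNReal.ofReal (1/4) := by
          rw [← ENNReal.ofReal_mul (by positivity)]
          apply ENNReal.ofReal_le_ofReal
          have : 32 / α * sN (v j) (v k) * (1/4) = sN (v j) (v k) * (8 / α) := by ring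
          rw [this]
          apply le_mul_of_one_le_right hs.le
          rw [le_div_iff₀ ha]; linarith [G.a4]
      _ ≤ ENNReal.ofReal (32 / α * sN (v j) (v k)) * (ENNReal.ofReal (sN (v j) (v k)) * volume (coneB v ![j, k] 1)) := by gcongr
      _ = _ := by
          rw [ENNReal.ofReal_mul (by positivity), sq, ENNReal.ofReal_mul hs.le]; ring

lemma sn_lower (G : Geo v α β) (j k l : Fin d) (h1 : j ≠ k) (h2 : k ≠ l) (h3 : j ≠ l) :
    α * β / 16 ≤ sN (v j) (v k) * nN (v j) (v k) (v l) := by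
  have key : ∀ p q r : Fin d, p ≠ q → q ≠ r → p ≠ r → -(1/2) ≤ v p ⬝ᵥ v q →
      (α * β / 16) ^ 2 ≤ 1 + 2 * (v p ⬝ᵥ v q) * (v p ⬝ᵥ v r) * (v q ⬝ᵥ v r) - (v p ⬝ᵥ v q) ^ 2 - (v p ⬝ᵥ v r) ^ 2 - (v q ⬝ᵥ v r) ^ 2 := by
    intro p q r hpq hqr hpr hc
    rw [← gram3 (G.hu p) (G.hu q) (G.hu r) (G.hs p q hpq)]
    have e1 := sN_lower (G.hu p) (G.hu q) α (G.hα p q hpq) hc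
    have e2 := G.hn p q r hpq hqr hpr
    have ha := G.ha
    have hb := G.hb
    have : α * β / 16 = α / 8 * (β / 2) := by ring
    rw [this]
    have := G.hs p q hpq
    gcongr
  have hsum : 0 ≤ (v j + v k + v l) ⬝ᵥ (v j + v k + v l) := dot_self_nonneg' _
  simp only [add_dotProduct, dotProduct_add, G.hu, dotProduct_comm (v k) (v j), dotProduct_comm (v l) (v j), dotProduct_comm (v l) (v k)] at hsum
  have hn := G.hn0 j k l h1 h2 h3
  have hs := G.hs j k h1
  refine (sq_le_sq₀ (by have := G.ha; have := G.hb; positivity) (by positivity)).1 ?_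
  rw [gram3 (G.hu j) (G.hu k) (G.hu l) hs]
  rcases le_or_gt (-(1/2)) (v j ⬝ᵥ v k) with c | c
  · exact key j k l h1 h2 h3 c
  rcases le_or_gt (-(1/2)) (v j ⬝ᵥ v l) with c' | c'
  · have := key j l k h3 h2.symm h1 c'
    rw [dotProduct_comm (v l) (v k)] at this
    linarith
  have c'' : -(1/2) ≤ v k ⬝ᵥ v l := by linarith
  have := key k l j h2 h3.symm h1.symm c''
  rw [dotProduct_comm (v l) (v j), dotProduct_comm (v k) (v j)] at this
  linarith

lemma wt3 (G : Geo v α β) (j k l : Fin d) (h1 : j ≠ k) (h2 : k ≠ l) (h3 : j ≠ l) :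
    ENNReal.ofReal (sN (v j) (v k) * nN (v j) (v k) (v l)) ≤
      ENNReal.ofReal (432 / (α * β)) * (ENNReal.ofReal (Gm v ![j, k, l]).det * volume (coneB v ![j, k, l] 1)) := by
  have hs := G.hs j k h1
  have hn := G.hn0 j k l h1 h2 h3
  have ha := G.ha
  have hb := G.hb
  rw [det3 G.hu j k l hs]
  have hk := kappa_box (m := 3) (σ := ![j, k, l]) G.hu
  have hl := sn_lower G j k l h1 h2 h3
  set x := sN (v j) (v k) * nN (v j) (v k) (v l)
  have hx : 0 < x := by positivity
  calc _ ≤ ENNReal.ofReal (432 / (α * β)) * (ENNReal.ofReal (x ^ 2) * ENNReal.ofReal ((1 / ((3:ℕ):ℝ)) ^ 3)) := by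
          rw [← ENNReal.ofReal_mul (by positivity), ← ENNReal.ofReal_mul (by positivity)]
          apply ENNReal.ofReal_le_ofReal
          have : 432 / (α * β) * (x ^ 2 * (1 / ((3:ℕ):ℝ)) ^ 3) = x * (16 * x / (α * β)) := by
            push_cast; ring
          rw [this]
          apply le_mul_of_one_le_right hx.le
          rw [le_div_iff₀ (by positivity)]; linarith
      _ ≤ _ := by gcongr

end kappa

open MeasureTheory Matrix Real

section decomp
variable {d : ℕ} (v : Fin d → (Fin d → ℝ)) (b : Fin d → ℝ) (g ρ : ℝ → ℝ)

/-- facet integrals -/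
noncomputable def Jc (j : Fin d) (w p : Fin d → ℝ) : ℝ := ∫ x, gW v b g ρ {j} x * (H2 w p x * gaussPDF d x)

/-- ridge integrals -/
noncomputable def Kc (j k : Fin d) (p : Fin d → ℝ) : ℝ := ∫ x, gW v b g ρ (insert k {j}) x * (H1 p x * gaussPDF d x)

/-- codimension three integrals -/
noncomputable def Lc (j k l : Fin d) : ℝ := ∫ x, gW v b g ρ (insert l (insert k {j})) x * gaussPDF d x

variable {v b g ρ} {α β : ℝ}

lemma Jc_symm (j : Fin d) (w p : Fin d → ℝ) : Jc v b g ρ j w p = Jc v b g ρ j p w := by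
  unfold Jc
  congr 1; ext x
  rw [H2, H2, dotProduct_comm w p, mul_comm (x ⬝ᵥ w)]

lemma Jc_add (h : GoodG g ρ) (j : Fin d) (w w' p : Fin d → ℝ) :
    Jc v b g ρ j (w + w') p = Jc v b g ρ j w p + Jc v b g ρ j w' p := by
  unfold Jc
  rw [← integral_add (gW_integrable h _ (H2_integrable _ _)) (gW_integrable h _ (H2_integrable _ _))]
  congr 1; ext x
  simp only [H2, dotProduct_add, add_dotProduct]; ring

lemma Jc_smul (j : Fin d) (c : ℝ) (w p : Fin d → ℝ) :
    Jc v b g ρ j (c • w) p = c * Jc v b g ρ j w p := by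
  unfold Jc
  rw [← integral_const_mul]
  congr 1; ext x
  simp only [H2, dotProduct_smul, smul_dotProduct, smul_eq_mul]; ring

lemma Kc_add (h : GoodG g ρ) (j k : Fin d) (w w' : Fin d → ℝ) :
    Kc v b g ρ j k (w + w') = Kc v b g ρ j k w + Kc v b g ρ j k w' := by
  unfold Kc
  rw [← integral_add (gW_integrable h _ (H1_integrable _)) (gW_integrable h _ (H1_integrable _))]
  congr 1; ext x
  simp only [H1, dotProduct_add]; ring

lemma Kc_smul (j k : Fin d) (c : ℝ) (w : Fin d → ℝ) :
    Kc v b g ρ j k (c • w) = c * Kc v b g ρ j k w := by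
  unfold Kc
  rw [← integral_const_mul]
  congr 1; ext x
  simp only [H1, dotProduct_smul, smul_eq_mul]; ring

lemma D3_ibp (h : GoodG g ρ) (q w p : Fin d → ℝ) :
    ∫ x, gW v b g ρ ∅ x * (H3 q w p x * gaussPDF d x) = ∑ j, (q ⬝ᵥ v j) * Jc v b g ρ j w p := by
  rw [gW_ibp h ∅ q (by simp) (fun x => H2_line x q w p) (H2_integrable _ _) (H3_integrable _ _ _)]
  simp [Jc]

lemma J_ibp (h : GoodG g ρ) (j : Fin d) (q p : Fin d → ℝ) (hq : q ⬝ᵥ v j = 0) :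
    Jc v b g ρ j q p = ∑ k ∈ ({j} : Finset (Fin d))ᶜ, (q ⬝ᵥ v k) * Kc v b g ρ j k p := by
  unfold Jc
  rw [gW_ibp h {j} q (by simpa using hq) (fun x => H1_line x q p) (H1_integrable _) (H2_integrable _ _)]
  simp [Kc]

lemma K_ibp (h : GoodG g ρ) (j k : Fin d) (q : Fin d → ℝ) (hq : q ⬝ᵥ v j = 0) (hq' : q ⬝ᵥ v k = 0) :
    Kc v b g ρ j k q = ∑ l ∈ (insert k {j} : Finset (Fin d))ᶜ, (q ⬝ᵥ v l) * Lc v b g ρ j k l := by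
  unfold Kc
  rw [gW_ibp h (insert k {j}) q (by simp [hq, hq']) (fun x => gaussPDF_line x q) (gauss_integrable _) (H1_integrable _)]
  simp [Lc]

lemma K_dec (h : GoodG g ρ) (G : Geo v α β) (j k : Fin d) (hjk : j ≠ k) (p : Fin d → ℝ) :
    Kc v b g ρ j k p = (v j ⬝ᵥ p) * Kc v b g ρ j k (v j) + (perpUnit (v j) (v k) ⬝ᵥ p) * Kc v b g ρ j k (perpUnit (v j) (v k))
      + ∑ l ∈ (insert k {j} : Finset (Fin d))ᶜ, nN (v j) (v k) (v l) * (perpUnit2 (v j) (v k) (v l) ⬝ᵥ p) * Lc v b g ρ j k l := by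
  have hs := G.hs j k hjk
  set y := perpUnit (v j) (v k) with hy
  have hyv : y ⬝ᵥ v j = 0 := perp_dot (G.hu j)
  have hyy : y ⬝ᵥ y = 1 := perp_unit (G.hu j) (G.hu k) hs
  have hvk : v k = sN (v j) (v k) • y + (v j ⬝ᵥ v k) • v j := by rw [hy, s_perp hs]; simp
  set q := p - (v j ⬝ᵥ p) • v j - (y ⬝ᵥ p) • y with hq
  have hp : p = (v j ⬝ᵥ p) • v j + (y ⬝ᵥ p) • y + q := by rw [hq]; abel
  have q1 : q ⬝ᵥ v j = 0 := by
    rw [hq]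
    simp only [sub_dotProduct, smul_dotProduct, smul_eq_mul, G.hu, hyv, dotProduct_comm p (v j)]; ring
  have q2 : q ⬝ᵥ y = 0 := by
    rw [hq]
    simp only [sub_dotProduct, smul_dotProduct, smul_eq_mul, hyy, dotProduct_comm (v j) y, hyv, dotProduct_comm p y]; ring
  have q3 : q ⬝ᵥ v k = 0 := by
    rw [hvk, dotProduct_add, dotProduct_smul, dotProduct_smul, q1, q2]; simp
  conv_lhs => rw [hp, Kc_add h, Kc_add h, Kc_smul, Kc_smul]
  rw [K_ibp h j k q q1 q3]
  congr 1
  refine Finset.sum_congr rfl fun l hl => ?_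
  simp at hl
  have hn := G.hn0 j k l hjk (Ne.symm hl.1) (Ne.symm hl.2)
  congr 1
  rw [n_perp2_dot hn, hq]
  simp only [sub_dotProduct, smul_dotProduct, smul_eq_mul, dotProduct_comm p (v l)]
  ring

lemma J_dec1 (h : GoodG g ρ) (G : Geo v α β) (j : Fin d) (w p : Fin d → ℝ) :
    Jc v b g ρ j w p = (v j ⬝ᵥ w) * Jc v b g ρ j (v j) p
      + ∑ k ∈ ({j} : Finset (Fin d))ᶜ, sN (v j) (v k) * (perpUnit (v j) (v k) ⬝ᵥ w) * Kc v b g ρ j k p := by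
  set q := w - (v j ⬝ᵥ w) • v j with hq
  have hp : w = (v j ⬝ᵥ w) • v j + q := by rw [hq]; abel
  have q1 : q ⬝ᵥ v j = 0 := by
    rw [hq]
    simp only [sub_dotProduct, smul_dotProduct, smul_eq_mul, G.hu, dotProduct_comm w (v j)]; ring
  conv_lhs => rw [hp, Jc_add h, Jc_smul]
  rw [J_ibp h j q p q1]
  congr 1
  refine Finset.sum_congr rfl fun k hk => ?_
  simp at hk
  have hs := G.hs j k (Ne.symm hk)
  congr 1
  rw [s_perp_dot hs, hq]
  simp only [sub_dotProduct, smul_dotProduct, smul_eq_mul, dotProduct_comm w (v k)]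
  ring

lemma J_dec (h : GoodG g ρ) (G : Geo v α β) (j : Fin d) (w p : Fin d → ℝ) :
    Jc v b g ρ j w p = (v j ⬝ᵥ w) * (v j ⬝ᵥ p) * Jc v b g ρ j (v j) (v j)
      + ∑ k ∈ ({j} : Finset (Fin d))ᶜ, (
        (sN (v j) (v k) * Kc v b g ρ j k (v j)) * ((v j ⬝ᵥ w) * (perpUnit (v j) (v k) ⬝ᵥ p))
        + (sN (v j) (v k) * Kc v b g ρ j k (v j)) * ((perpUnit (v j) (v k) ⬝ᵥ w) * (v j ⬝ᵥ p))
        + (sN (v j) (v k) * Kc v b g ρ j k (perpUnit (v j) (v k))) * ((perpUnit (v j) (v k) ⬝ᵥ w) * (perpUnit (v j) (v k) ⬝ᵥ p))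
        + ∑ l ∈ (insert k {j} : Finset (Fin d))ᶜ, (sN (v j) (v k) * nN (v j) (v k) (v l) * Lc v b g ρ j k l) *
          ((perpUnit (v j) (v k) ⬝ᵥ w) * (perpUnit2 (v j) (v k) (v l) ⬝ᵥ p))) := by
  rw [J_dec1 h G j w p, Jc_symm j (v j) p, J_dec1 h G j p (v j), mul_add, add_assoc, ← mul_assoc, Finset.mul_sum, ← Finset.sum_add_distrib]
  congr 1
  refine Finset.sum_congr rfl fun k hk => ?_
  simp at hk
  rw [K_dec h G j k (Ne.symm hk) p, mul_add, mul_add, Finset.mul_sum]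
  rw [← add_assoc, ← add_assoc]
  congr 1
  · ring
  · refine Finset.sum_congr rfl fun l _ => ?_
    ring

/-- tensor contraction -/
noncomputable def tc (T : Fin d → Fin d → Fin d → ℝ) : (Fin d → Fin d → Fin d → ℝ) →ₗ[ℝ] ℝ where
  toFun f := ∑ a, ∑ c, ∑ e, T a c e * f a c e
  map_add' f f' := by simp [mul_add, Finset.sum_add_distrib]
  map_smul' c f := by
    simp only [Pi.smul_apply, smul_eq_mul, RingHom.id_apply, Finset.mul_sum]
    refine Finset.sum_congr rfl fun _ _ => Finset.sum_congr rfl fun _ _ => Finset.sum_congr rfl fun _ _ => ?_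
    ring

/-- rank one tensor -/
def tp (u w p : Fin d → ℝ) : Fin d → Fin d → Fin d → ℝ := fun a c e => u a * w c * p e

lemma D3_tensor (h : GoodG g ρ) (G : Geo v α β) :
    (fun a c e => ∫ x, gW v b g ρ ∅ x * (H3 (Pi.single a 1) (Pi.single c 1) (Pi.single e 1) x * gaussPDF d x)) =
    ∑ j, (Jc v b g ρ j (v j) (v j) • tp (v j) (v j) (v j)
      + ∑ k ∈ ({j} : Finset (Fin d))ᶜ, (
        (sN (v j) (v k) * Kc v b g ρ j k (v j)) • tp (v j) (v j) (perpUnit (v j) (v k))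
        + (sN (v j) (v k) * Kc v b g ρ j k (v j)) • tp (v j) (perpUnit (v j) (v k)) (v j)
        + (sN (v j) (v k) * Kc v b g ρ j k (perpUnit (v j) (v k))) • tp (v j) (perpUnit (v j) (v k)) (perpUnit (v j) (v k))
        + ∑ l ∈ (insert k {j} : Finset (Fin d))ᶜ, (sN (v j) (v k) * nN (v j) (v k) (v l) * Lc v b g ρ j k l) •
          tp (v j) (perpUnit (v j) (v k)) (perpUnit2 (v j) (v k) (v l)))) := by
  ext a c e
  rw [D3_ibp h]
  simp only [Finset.sum_apply, Pi.add_apply, Pi.smul_apply, smul_eq_mul, tp]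
  refine Finset.sum_congr rfl fun j _ => ?_
  rw [J_dec h G]
  simp only [single_one_dotProduct, dotProduct_single_one]
  rw [mul_add, Finset.mul_sum]
  congr 1
  · ring
  · refine Finset.sum_congr rfl fun k _ => ?_
    rw [mul_add, Finset.mul_sum]
    congr 1
    · ring
    · refine Finset.sum_congr rfl fun l _ => ?_
      ring

lemma tc_bound (h : GoodG g ρ) (G : Geo v α β) (T : Fin d → Fin d → Fin d → ℝ) (M : ℝ)
    (m1 : ∀ j, |tc T (tp (v j) (v j) (v j))| ≤ M)
    (m2 : ∀ j k, j ≠ k → |tc T (tp (v j) (v j) (perpUnit (v j) (v k)))| ≤ M)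
    (m3 : ∀ j k, j ≠ k → |tc T (tp (v j) (perpUnit (v j) (v k)) (v j))| ≤ M)
    (m4 : ∀ j k, j ≠ k → |tc T (tp (v j) (perpUnit (v j) (v k)) (perpUnit (v j) (v k)))| ≤ M)
    (m5 : ∀ j k l, j ≠ k → k ≠ l → j ≠ l → |tc T (tp (v j) (perpUnit (v j) (v k)) (perpUnit2 (v j) (v k) (v l)))| ≤ M) :
    |tc T (fun a c e => ∫ x, gW v b g ρ ∅ x * (H3 (Pi.single a 1) (Pi.single c 1) (Pi.single e 1) x * gaussPDF d x))| ≤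
      M * (∑ j, |Jc v b g ρ j (v j) (v j)|
        + 2 * ∑ j, ∑ k ∈ ({j} : Finset (Fin d))ᶜ, sN (v j) (v k) * |Kc v b g ρ j k (v j)|
        + ∑ j, ∑ k ∈ ({j} : Finset (Fin d))ᶜ, sN (v j) (v k) * |Kc v b g ρ j k (perpUnit (v j) (v k))|
        + ∑ j, ∑ k ∈ ({j} : Finset (Fin d))ᶜ, ∑ l ∈ (insert k {j} : Finset (Fin d))ᶜ, sN (v j) (v k) * nN (v j) (v k) (v l) * |Lc v b g ρ j k l|) := by
  have aux : ∀ (x y : ℝ), |x| ≤ M → |y * x| ≤ M * |y| := by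
    intro x y hx
    rw [abs_mul, mul_comm]
    exact mul_le_mul_of_nonneg_right hx (abs_nonneg _)
  have s0 : ∀ j k, 0 ≤ sN (v j) (v k) := fun _ _ => Real.sqrt_nonneg _
  have n0 : ∀ j k l, 0 ≤ nN (v j) (v k) (v l) := fun _ _ _ => Real.sqrt_nonneg _
  rw [D3_tensor h G]
  simp only [map_sum, map_add, map_smul, smul_eq_mul]
  calc _ ≤ ∑ j, (M * |Jc v b g ρ j (v j) (v j)| + ∑ k ∈ ({j} : Finset (Fin d))ᶜ,
        (M * (sN (v j) (v k) * |Kc v b g ρ j k (v j)|) + M * (sN (v j) (v k) * |Kc v b g ρ j k (v j)|)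
        + M * (sN (v j) (v k) * |Kc v b g ρ j k (perpUnit (v j) (v k))|)
        + ∑ l ∈ (insert k {j} : Finset (Fin d))ᶜ, M * (sN (v j) (v k) * nN (v j) (v k) (v l) * |Lc v b g ρ j k l|))) := by
        refine (Finset.abs_sum_le_sum_abs _ _).trans (Finset.sum_le_sum fun j _ => ?_)
        refine (abs_add_le _ _).trans (add_le_add (aux _ _ (m1 j)) ?_)
        refine (Finset.abs_sum_le_sum_abs _ _).trans (Finset.sum_le_sum fun k hk => ?_)
        simp at hk
        have hjk : j ≠ k := Ne.symm hk
        refine (abs_add_le _ _).trans (add_le_add ((abs_add_le _ _).trans (add_le_add ((abs_add_le _ _).trans (add_le_add ?_ ?_)) ?_)) ?_)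
        · refine (aux _ _ (m2 j k hjk)).trans (le_of_eq ?_)
          rw [abs_mul, abs_of_nonneg (s0 j k)]
        · refine (aux _ _ (m3 j k hjk)).trans (le_of_eq ?_)
          rw [abs_mul, abs_of_nonneg (s0 j k)]
        · refine (aux _ _ (m4 j k hjk)).trans (le_of_eq ?_)
          rw [abs_mul, abs_of_nonneg (s0 j k)]
        · refine (Finset.abs_sum_le_sum_abs _ _).trans (Finset.sum_le_sum fun l hl => ?_)
          simp at hl
          refine (aux _ _ (m5 j k l hjk (Ne.symm hl.1) (Ne.symm hl.2))).trans (le_of_eq ?_)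
          rw [abs_mul, abs_mul, abs_of_nonneg (s0 j k), abs_of_nonneg (n0 j k l)]
    _ = _ := by
        simp only [Finset.sum_add_distrib, ← Finset.mul_sum]
        ring

end decomp

open MeasureTheory Matrix Real

section sums
variable {d : ℕ}

lemma eta1 (σ : Fin 1 → Fin d) : ![σ 0] = σ := by ext i; fin_cases i; rfl
lemma eta2 (σ : Fin 2 → Fin d) : ![σ 0, σ 1] = σ := by ext i; fin_cases i <;> rfl
lemma eta3 (σ : Fin 3 → Fin d) : ![σ 0, σ 1, σ 2] = σ := by ext i; fin_cases i <;> rfl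

lemma inj2 {j k : Fin d} (h : j ≠ k) : Function.Injective ![j, k] := by
  intro a c hac
  fin_cases a <;> fin_cases c <;> simp_all

lemma inj3 {j k l : Fin d} (h1 : j ≠ k) (h2 : k ≠ l) (h3 : j ≠ l) : Function.Injective ![j, k, l] := by
  intro a c hac
  fin_cases a <;> fin_cases c <;> simp_all

/-- injective tuples -/
noncomputable def Sinj (d m : ℕ) : Finset (Fin m → Fin d) := by
  classical exact Finset.univ.filter Function.Injective

lemma mem_Sinj {m : ℕ} {σ : Fin m → Fin d} : σ ∈ Sinj d m ↔ Function.Injective σ := by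
  simp [Sinj]

lemma sum1 (F : (Fin 1 → Fin d) → ℝ) : ∑ j, F ![j] = ∑ σ ∈ Sinj d 1, F σ := by
  refine Finset.sum_nbij' (fun j => ![j]) (fun σ => σ 0) ?_ ?_ ?_ ?_ ?_
  · intro j _; rw [mem_Sinj]; exact Function.injective_of_subsingleton _
  · simp
  · simp
  · intro σ _; exact eta1 σ
  · simp

lemma sum2 (F : (Fin 2 → Fin d) → ℝ) : ∑ j, ∑ k ∈ ({j} : Finset (Fin d))ᶜ, F ![j, k] = ∑ σ ∈ Sinj d 2, F σ := by
  rw [Finset.sum_sigma']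
  refine Finset.sum_nbij' (fun p => ![p.1, p.2]) (fun σ => ⟨σ 0, σ 1⟩) ?_ ?_ ?_ ?_ ?_
  · rintro ⟨j, k⟩ hp
    simp at hp
    rw [mem_Sinj]; exact inj2 (Ne.symm hp)
  · intro σ hσ
    rw [mem_Sinj] at hσ
    simp only [Finset.mem_sigma, Finset.mem_univ, true_and, Finset.mem_compl, Finset.mem_singleton]
    exact hσ.ne (by decide)
  · rintro ⟨j, k⟩ _; rfl
  · intro σ _; exact eta2 σ
  · simp

lemma sum3 (F : (Fin 3 → Fin d) → ℝ) : ∑ j, ∑ k ∈ ({j} : Finset (Fin d))ᶜ, ∑ l ∈ (insert k {j} : Finset (Fin d))ᶜ, F ![j, k, l]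
    = ∑ σ ∈ Sinj d 3, F σ := by
  simp_rw [Finset.sum_sigma']
  refine Finset.sum_nbij' (fun p => ![p.1, p.2.1, p.2.2]) (fun σ => ⟨σ 0, ⟨σ 1, σ 2⟩⟩) ?_ ?_ ?_ ?_ ?_
  · rintro ⟨j, k, l⟩ hp
    simp at hp
    rw [mem_Sinj]; exact inj3 (Ne.symm hp.1) (Ne.symm hp.2.1) (Ne.symm hp.2.2)
  · intro σ hσ
    rw [mem_Sinj] at hσ
    simp only [Finset.mem_sigma, Finset.mem_univ, true_and, Finset.mem_compl, Finset.mem_singleton, Finset.mem_insert, not_or]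
    exact ⟨hσ.ne (by decide), hσ.ne (by decide), hσ.ne (by decide)⟩
  · rintro ⟨j, k, l⟩ _; rfl
  · intro σ _; exact eta3 σ
  · simp

lemma img1 (j : Fin d) : Finset.univ.image ![j] = {j} := by ext x; simp
lemma img2 (j k : Fin d) : Finset.univ.image ![j, k] = insert k {j} := by
  ext x; simp [Fin.exists_fin_two]; tauto
lemma img3 (j k l : Fin d) : Finset.univ.image ![j, k, l] = insert l (insert k {j}) := by
  ext x; simp [Fin.exists_fin_succ]; tauto
end sums

section numeric
variable {d : ℕ} {v : Fin d → (Fin d → ℝ)} {b : Fin d → ℝ} {g ρ : ℝ → ℝ} {α β : ℝ}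

lemma exp_tail (q : ℝ) : 1 + q ≤ 4 * Real.exp (q / 4) := by
  have := Real.add_one_le_exp (q / 4)
  linarith

lemma exp32 : Real.exp (3/2) ≤ 9 := by
  have h1 : Real.exp (3/2) ≤ Real.exp 1 * Real.exp 1 := by
    rw [← Real.exp_add]; apply Real.exp_le_exp.2; norm_num
  have h2 := Real.exp_one_lt_d9
  have h3 := Real.exp_pos 1
  nlinarith

lemma exp12 : Real.exp (1/2) ≤ 9 := (Real.exp_le_exp.2 (by norm_num)).trans exp32

lemma num_bound (R D K : ℝ) (m : ℕ) (hR : 1 ≤ R) (hD : 0 ≤ D) (hK0 : 0 ≤ K) (hK : K * R ^ m ≤ R ^ 3)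
    (hd : Real.exp (-R ^ 2 / 4) * ((d ^ m : ℕ) : ℝ) ≤ 1) :
    D * (K * (Real.exp (3/2) * R ^ m * (m ^ m : ℕ)) + 4 * Real.exp (-R ^ 2 / 4) * (Real.exp (1/2) * (d ^ m : ℕ))) ≤
      D * ((9 * (m ^ m : ℕ) + 36) * R ^ 3) := by
  refine mul_le_mul_of_nonneg_left ?_ hD
  have h1 : (1:ℝ) ≤ R ^ 3 := one_le_pow₀ hR
  have e1 : K * (Real.exp (3/2) * R ^ m * (m ^ m : ℕ)) ≤ 9 * (m ^ m : ℕ) * R ^ 3 := by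
    calc _ = Real.exp (3/2) * (m ^ m : ℕ) * (K * R ^ m) := by ring
      _ ≤ 9 * (m ^ m : ℕ) * R ^ 3 := by
        have := exp32
        gcongr
  have e2 : 4 * Real.exp (-R ^ 2 / 4) * (Real.exp (1/2) * (d ^ m : ℕ)) ≤ 36 * R ^ 3 := by
    calc _ = 4 * Real.exp (1/2) * (Real.exp (-R ^ 2 / 4) * ((d ^ m : ℕ) : ℝ)) := by ring
      _ ≤ 4 * 9 * 1 := by
        have := exp12
        gcongr
      _ ≤ _ := by linarith
  linarith

lemma lin_psi {q Q : ℝ} (h : q ^ 2 ≤ Q) : |q| ≤ 1 + Q := by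
  rw [abs_le]; constructor <;> nlinarith

lemma J_sum (h : GoodG g ρ) (G : Geo v α β) (R : ℝ) (hR : 1 ≤ R) (hd : Real.exp (-R ^ 2 / 4) * ((d ^ 1 : ℕ) : ℝ) ≤ 1) :
    ∑ j, |Jc v b g ρ j (v j) (v j)| ≤ 45 * R ^ 3 := by
  have hq : ∀ (σ : Fin 1 → Fin d) x, (x ⬝ᵥ v (σ 0)) ^ 2 ≤ Qx v σ x := by
    intro σ x
    have e : v (σ 0) = cmb v σ ![1] := by simp [cmb]
    have hdet : 0 < (Gm v σ).det := by rw [← eta1 σ, det1 G.hu]; norm_num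
    have := dot_cmb_sq_le hdet x ![1]
    rw [← e, G.hu, mul_one] at this
    exact this
  have hR2 : 1 ≤ R ^ 2 := one_le_pow₀ hR
  have key := Bfin (v := v) (b := b) h (Sinj d 1) (fun σ hσ => mem_Sinj.1 hσ) 
    (fun σ _ => by rw [← eta1 σ, det1 G.hu]; norm_num) R hR (R ^ 2) (by positivity)
    (fun σ x => H2 (v (σ 0)) (v (σ 0)) x)
    (by
      intro σ _ x hx
      have := hq σ x
      simp only [H2, G.hu]
      rw [abs_le]
      constructor <;> nlinarith)
    (by
      intro σ _ x
      have := hq σ x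
      refine le_trans ?_ (exp_tail _)
      simp only [H2, G.hu]
      rw [abs_le]
      constructor <;> nlinarith)
    (fun _ => 1) (fun _ _ => zero_le_one) 1 zero_le_one
    (fun σ _ => by rw [← eta1 σ]; exact wt1 G (σ 0))
  rw [← sum1] at key
  simp only [img1, one_mul] at key
  refine (le_of_eq ?_).trans (key.trans ?_)
  · rfl
  · have := num_bound (d := d) R 1 (R ^ 2) 1 hR zero_le_one (by positivity) (by rw [← pow_add]) hd
    rw [one_mul, one_mul] at this
    refine this.trans (le_of_eq ?_)
    norm_num

lemma K_sum (h : GoodG g ρ) (G : Geo v α β) (R : ℝ) (hR : 1 ≤ R) (hd : Real.exp (-R ^ 2 / 4) * ((d ^ 2 : ℕ) : ℝ) ≤ 1)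
    (u : (Fin 2 → Fin d) → (Fin d → ℝ)) (hu1 : ∀ σ ∈ Sinj d 2, u σ ⬝ᵥ u σ = 1) (hu2 : ∀ σ ∈ Sinj d 2, ∃ t, u σ = cmb v σ t) :
    ∑ j, ∑ k ∈ ({j} : Finset (Fin d))ᶜ, sN (v j) (v k) * |Kc v b g ρ j k (u ![j, k])| ≤ 32 / α * (72 * R ^ 3) := by
  have hdet : ∀ σ ∈ Sinj d 2, 0 < (Gm v σ).det := by
    intro σ hσ
    rw [← eta2 σ, det2 G.hu]
    have := G.hs (σ 0) (σ 1) ((mem_Sinj.1 hσ).ne (by decide))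
    positivity
  have hq : ∀ σ ∈ Sinj d 2, ∀ x, (x ⬝ᵥ u σ) ^ 2 ≤ Qx v σ x := by
    intro σ hσ x
    obtain ⟨t, ht⟩ := hu2 σ hσ
    have := dot_cmb_sq_le (hdet σ hσ) x t
    rw [← ht, hu1 σ hσ, mul_one] at this
    exact this
  have ha := G.ha
  have key := Bfin (v := v) (b := b) h (Sinj d 2) (fun σ hσ => mem_Sinj.1 hσ) hdet R hR R (by positivity)
    (fun σ x => H1 (u σ) x)
    (by
      intro σ hσ x hx
      have := hq σ hσ x
      simp only [H1, abs_neg]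
      exact abs_le_of_sq_le_sq (this.trans hx) (by positivity))
    (by
      intro σ hσ x
      refine le_trans ?_ (exp_tail _)
      simp only [H1, abs_neg]
      exact lin_psi (hq σ hσ x))
    (fun σ => sN (v (σ 0)) (v (σ 1))) (fun _ _ => Real.sqrt_nonneg _) (32 / α) (by positivity)
    (fun σ hσ => by
      have := wt2 G (σ 0) (σ 1) ((mem_Sinj.1 hσ).ne (by decide))
      rwa [eta2] at this)
  rw [← sum2] at key
  simp only [img2] at key
  refine (le_of_eq ?_).trans (key.trans ?_)
  · rfl
  · have := num_bound (d := d) R (32 / α) R 2 hR (by positivity) (by positivity) (le_of_eq (by ring)) hd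
    refine this.trans (le_of_eq ?_)
    norm_num

lemma L_sum (h : GoodG g ρ) (G : Geo v α β) (R : ℝ) (hR : 1 ≤ R) (hd : Real.exp (-R ^ 2 / 4) * ((d ^ 3 : ℕ) : ℝ) ≤ 1) :
    ∑ j, ∑ k ∈ ({j} : Finset (Fin d))ᶜ, ∑ l ∈ (insert k {j} : Finset (Fin d))ᶜ, sN (v j) (v k) * nN (v j) (v k) (v l) * |Lc v b g ρ j k l|
      ≤ 432 / (α * β) * (279 * R ^ 3) := by
  have hne : ∀ σ ∈ Sinj d 3, σ 0 ≠ σ 1 ∧ σ 1 ≠ σ 2 ∧ σ 0 ≠ σ 2 := fun σ hσ =>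
    ⟨(mem_Sinj.1 hσ).ne (by decide), (mem_Sinj.1 hσ).ne (by decide), (mem_Sinj.1 hσ).ne (by decide)⟩
  have hdet : ∀ σ ∈ Sinj d 3, 0 < (Gm v σ).det := by
    intro σ hσ
    obtain ⟨h1, h2, h3⟩ := hne σ hσ
    have hs := G.hs _ _ h1
    rw [← eta3 σ, det3 G.hu _ _ _ hs]
    have := G.hn0 _ _ _ h1 h2 h3
    positivity
  have ha := G.ha
  have hb := G.hb
  have key := Bfin (v := v) (b := b) h (Sinj d 3) (fun σ hσ => mem_Sinj.1 hσ) hdet R hR 1 zero_le_one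
    (fun σ x => 1)
    (by intro σ hσ x hx; simp)
    (by
      intro σ hσ x
      refine le_trans ?_ (exp_tail _)
      have := Qx_nonneg (v := v) (σ := σ) x
      simpa using this)
    (fun σ => sN (v (σ 0)) (v (σ 1)) * nN (v (σ 0)) (v (σ 1)) (v (σ 2)))
    (fun _ _ => mul_nonneg (Real.sqrt_nonneg _) (Real.sqrt_nonneg _)) (432 / (α * β)) (by positivity)
    (fun σ hσ => by
      obtain ⟨h1, h2, h3⟩ := hne σ hσ
      have := wt3 G (σ 0) (σ 1) (σ 2) h1 h2 h3
      rwa [eta3] at this)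
  rw [← sum3] at key
  simp only [img3, one_mul] at key
  refine (le_of_eq ?_).trans (key.trans ?_)
  · rfl
  · have := num_bound (d := d) R (432 / (α * β)) 1 3 hR (by positivity) (by positivity) (le_of_eq (by ring)) hd
    rw [one_mul] at this
    refine this.trans (le_of_eq ?_)
    norm_num

lemma all_sum (h : GoodG g ρ) (G : Geo v α β) (hd3 : 3 ≤ d) :
    (∑ j, |Jc v b g ρ j (v j) (v j)|
        + 2 * ∑ j, ∑ k ∈ ({j} : Finset (Fin d))ᶜ, sN (v j) (v k) * |Kc v b g ρ j k (v j)|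
        + ∑ j, ∑ k ∈ ({j} : Finset (Fin d))ᶜ, sN (v j) (v k) * |Kc v b g ρ j k (perpUnit (v j) (v k))|
        + ∑ j, ∑ k ∈ ({j} : Finset (Fin d))ᶜ, ∑ l ∈ (insert k {j} : Finset (Fin d))ᶜ, sN (v j) (v k) * nN (v j) (v k) (v l) * |Lc v b g ρ j k l|)
      ≤ (148896 * 12 ^ ((3:ℝ)/2)) * Real.log d ^ ((3 : ℝ) / 2) / (α * β) := by
  have ha := G.ha
  have hb := G.hb
  have hd0 : (0:ℝ) < d := by positivity
  have hlog : 1 ≤ Real.log d := by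
    rw [Real.le_log_iff_exp_le hd0]
    have : (3:ℝ) ≤ d := by exact_mod_cast hd3
    linarith [Real.exp_one_lt_d9]
  set R := Real.sqrt (12 * Real.log d) with hRdef
  have hR2 : R ^ 2 = 12 * Real.log d := Real.sq_sqrt (by positivity)
  have hR : 1 ≤ R := Real.le_sqrt_of_sq_le (by linarith)
  have hR3 : R ^ 3 = 12 ^ ((3:ℝ)/2) * Real.log d ^ ((3 : ℝ) / 2) := by
    rw [← Real.mul_rpow (by norm_num) (by positivity), hRdef, Real.sqrt_eq_rpow, ← Real.rpow_natCast, ← Real.rpow_mul (by positivity)]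
    norm_num
  have hexp : Real.exp (-R ^ 2 / 4) = ((d:ℝ) ^ 3)⁻¹ := by
    rw [show -R ^ 2 / 4 = -(((3:ℕ):ℝ) * Real.log d) by rw [hR2]; push_cast; ring, Real.exp_neg, Real.exp_nat_mul, Real.exp_log hd0]
  have hdm : ∀ m : ℕ, m ≤ 3 → Real.exp (-R ^ 2 / 4) * ((d ^ m : ℕ) : ℝ) ≤ 1 := by
    intro m hm
    rw [hexp, inv_mul_le_iff₀ (by positivity), mul_one]
    push_cast
    exact pow_le_pow_right₀ (by exact_mod_cast (by omega : 1 ≤ d)) hm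
  have h1 := J_sum (b := b) h G R hR (hdm 1 (by norm_num))
  have h2 := K_sum (b := b) h G R hR (hdm 2 (by norm_num)) (fun σ => v (σ 0)) (fun σ _ => G.hu _)
    (fun σ _ => ⟨![1, 0], by simp [cmb, Fin.sum_univ_two]⟩)
  have h3 := K_sum (b := b) h G R hR (hdm 2 (by norm_num)) (fun σ => perpUnit (v (σ 0)) (v (σ 1)))
    (fun σ hσ => perp_unit (G.hu _) (G.hu _) (G.hs _ _ ((mem_Sinj.1 hσ).ne (by decide))))
    (fun σ _ => ⟨![-((sN (v (σ 0)) (v (σ 1)))⁻¹ * (v (σ 0) ⬝ᵥ v (σ 1))), (sN (v (σ 0)) (v (σ 1)))⁻¹], by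
      rw [perp_eq]
      simp only [cmb, Fin.sum_univ_two, Matrix.cons_val_zero, Matrix.cons_val_one, smul_sub, smul_smul, neg_smul]
      abel⟩)
  have h4 := L_sum (b := b) h G R hR (hdm 3 (by norm_num))
  simp only [Matrix.cons_val_zero, Matrix.cons_val_one] at h2 h3
  have hR30 : 0 ≤ R ^ 3 := by positivity
  have hab : α * β ≤ 16 := by nlinarith [G.a4, G.b4]
  have e1 : 45 * R ^ 3 ≤ 720 * R ^ 3 / (α * β) := by
    rw [le_div_iff₀ (by positivity)]; nlinarith
  have e2 : 32 / α * (72 * R ^ 3) ≤ 9216 * R ^ 3 / (α * β) := by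
    rw [div_mul_eq_mul_div, div_le_div_iff₀ ha (by positivity)]
    have := mul_le_mul_of_nonneg_left G.b4 (by positivity : 0 ≤ 32 * (72 * R ^ 3) * α)
    linarith
  have e3 : 432 / (α * β) * (279 * R ^ 3) = 120528 * R ^ 3 / (α * β) := by ring
  calc _ ≤ 720 * R ^ 3 / (α * β) + 2 * (9216 * R ^ 3 / (α * β)) + 9216 * R ^ 3 / (α * β) + 120528 * R ^ 3 / (α * β) := by
        linarith
    _ = 148896 * R ^ 3 / (α * β) := by ring
    _ = _ := by rw [hR3]; ring

end numeric

open MeasureTheory Matrix Real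

/-- smooth approximate step functions -/
noncomputable def gs (n : ℕ) (t : ℝ) : ℝ := Real.smoothTransition (((n:ℝ) + 1) * t + 1)

lemma gs_one (n : ℕ) {t : ℝ} (ht : 0 ≤ t) : gs n t = 1 :=
  Real.smoothTransition.one_of_one_le (by have : 0 ≤ ((n:ℝ) + 1) * t := by positivity
                                          linarith)

lemma gs_zero (n : ℕ) {t : ℝ} (ht : ((n:ℝ) + 1) * t + 1 ≤ 0) : gs n t = 0 :=
  Real.smoothTransition.zero_of_nonpos ht

lemma gs_zero' (n : ℕ) {t : ℝ} (ht : t ≤ -1) : gs n t = 0 := by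
  apply gs_zero
  have : (0:ℝ) ≤ n := by positivity
  nlinarith

lemma gs_contDiff (n : ℕ) : ContDiff ℝ 1 (gs n) := by
  unfold gs
  exact (Real.smoothTransition.contDiff (n := 1)).comp (by fun_prop)

lemma gs_good (n : ℕ) : GoodG (gs n) (deriv (gs n)) := by
  have hmono : Monotone (gs n) := by
    intro s t hst
    apply Real.smoothTransition.monotone
    have : (0:ℝ) ≤ (n:ℝ) + 1 := by positivity
    have := mul_le_mul_of_nonneg_left hst this
    linarith
  have hd : ∀ t, HasDerivAt (gs n) (deriv (gs n) t) t := fun t =>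
    (((gs_contDiff n).differentiable (by norm_num)) t).hasDerivAt
  have hc : Continuous (deriv (gs n)) := (gs_contDiff n).continuous_deriv (by norm_num)
  have hsupp : HasCompactSupport (deriv (gs n)) := by
    refine HasCompactSupport.intro (isCompact_Icc (a := (-1:ℝ)) (b := 0)) fun t ht => ?_
    rcases lt_or_ge t (-1) with h | h
    · have : gs n =ᶠ[nhds t] fun _ => 0 := by
        filter_upwards [Iio_mem_nhds h] with s hs
        exact gs_zero' n (le_of_lt hs)
      rw [this.deriv_eq]; simp
    · have h0 : 0 < t := by
        by_contra hcon
        exact ht ⟨h, by linarith⟩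
      have : gs n =ᶠ[nhds t] fun _ => 1 := by
        filter_upwards [Ioi_mem_nhds h0] with s hs
        exact gs_one n (le_of_lt hs)
      rw [this.deriv_eq]; simp
  have hdgs : Integrable (deriv (gs n)) := hc.integrable_of_hasCompactSupport hsupp
  have hbot : Filter.Tendsto (gs n) Filter.atBot (nhds 0) := by
    refine tendsto_const_nhds.congr' ?_
    filter_upwards [Filter.eventually_le_atBot (-1)] with t ht
    exact (gs_zero' n ht).symm
  have htop : Filter.Tendsto (gs n) Filter.atTop (nhds 1) := by
    refine tendsto_const_nhds.congr' ?_
    filter_upwards [Filter.eventually_ge_atTop 0] with t ht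
    exact (gs_one n ht).symm
  obtain ⟨B, hB⟩ := hc.bounded_above_of_compact_support hsupp
  refine ⟨hd, hc, fun t => hmono.deriv_nonneg, fun t => Real.smoothTransition.nonneg _,
    fun t => Real.smoothTransition.le_one _, ⟨B, (norm_nonneg _).trans (hB 0), fun t => (le_abs_self _).trans (hB t)⟩, hdgs, ?_, ?_⟩
  · intro t
    rw [integral_Iic_of_hasDerivAt_of_tendsto' (fun x _ => hd x) hdgs.integrableOn hbot, sub_zero]
  · rw [integral_of_hasDerivAt_of_tendsto hd hdgs hbot htop, sub_zero]

section final
variable {d : ℕ} {v : Fin d → (Fin d → ℝ)} {b : Fin d → ℝ} {α β : ℝ}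

lemma gW_lim (F : (Fin d → ℝ) → ℝ) (x : Fin d → ℝ) :
    Filter.Tendsto (fun n => gW v b (gs n) (deriv (gs n)) ∅ x * F x) Filter.atTop
      (nhds ({x : Fin d → ℝ | ∀ j, x ⬝ᵥ v j ≤ b j}.indicator F x)) := by
  by_cases hx : ∀ j, x ⬝ᵥ v j ≤ b j
  · rw [Set.indicator_of_mem (show x ∈ {x : Fin d → ℝ | ∀ j, x ⬝ᵥ v j ≤ b j} from hx)]
    refine tendsto_const_nhds.congr fun n => ?_
    have : gW v b (gs n) (deriv (gs n)) ∅ x = 1 := by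
      simp only [gW, Finset.prod_empty, one_mul]
      exact Finset.prod_eq_one fun l _ => gs_one n (by linarith [hx l])
    rw [this, one_mul]
  · rw [Set.indicator_of_notMem (show x ∉ {x : Fin d → ℝ | ∀ j, x ⬝ᵥ v j ≤ b j} from hx)]
    push Not at hx
    obtain ⟨j, hj⟩ := hx
    refine tendsto_const_nhds.congr' ?_
    obtain ⟨N, hN⟩ := exists_nat_gt (1 / (x ⬝ᵥ v j - b j))
    filter_upwards [Filter.eventually_ge_atTop N] with n hn
    have hpos : 0 < x ⬝ᵥ v j - b j := by linarith
    have h1 : gs n (b j - x ⬝ᵥ v j) = 0 := by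
      apply gs_zero
      rw [div_lt_iff₀ hpos] at hN
      have : (N:ℝ) ≤ n := by exact_mod_cast hn
      nlinarith
    have : gW v b (gs n) (deriv (gs n)) ∅ x = 0 := by
      simp only [gW, Finset.prod_empty, one_mul]
      exact Finset.prod_eq_zero (by simp : j ∈ (∅ : Finset (Fin d))ᶜ) h1
    rw [this, zero_mul]

lemma int_lim (F : (Fin d → ℝ) → ℝ) (hF : Integrable F) :
    Filter.Tendsto (fun n => ∫ x, gW v b (gs n) (deriv (gs n)) ∅ x * F x) Filter.atTop
      (nhds (∫ x in {x : Fin d → ℝ | ∀ j, x ⬝ᵥ v j ≤ b j}, F x)) := by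
  have hm : MeasurableSet {x : Fin d → ℝ | ∀ j, x ⬝ᵥ v j ≤ b j} := by
    have : {x : Fin d → ℝ | ∀ j, x ⬝ᵥ v j ≤ b j} = ⋂ j, {x | x ⬝ᵥ v j ≤ b j} := by ext; simp
    rw [this]
    exact MeasurableSet.iInter fun j => measurableSet_le (dot_cont _).measurable measurable_const
  rw [← integral_indicator hm]
  refine tendsto_integral_of_dominated_convergence (fun x => |F x|) ?_ hF.abs ?_ ?_
  · intro n
    exact (gW_integrable (gs_good n) ∅ hF).aestronglyMeasurable
  · intro n
    refine Filter.Eventually.of_forall fun x => ?_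
    rw [norm_mul, Real.norm_eq_abs, Real.norm_eq_abs, abs_of_nonneg (gW_nonneg (gs_good n) ∅ x)]
    refine mul_le_of_le_one_left (abs_nonneg _) ?_
    simpa using gW_le (v := v) (b := b) (gs_good n) ∅ x
  · exact Filter.Eventually.of_forall fun x => gW_lim F x

lemma tc_int (T : Fin d → Fin d → Fin d → ℝ) (n : ℕ) :
    ∫ x, gW v b (gs n) (deriv (gs n)) ∅ x * (∑ a, ∑ c, ∑ e, T a c e * gaussPDF3 d a c e x) =
    tc T (fun a c e => ∫ x, gW v b (gs n) (deriv (gs n)) ∅ x * (H3 (Pi.single a 1) (Pi.single c 1) (Pi.single e 1) x * gaussPDF d x)) := by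
  have hi : ∀ a c e : Fin d, Integrable fun x => T a c e * (gW v b (gs n) (deriv (gs n)) ∅ x * (H3 (Pi.single a 1) (Pi.single c 1) (Pi.single e 1) x * gaussPDF d x)) :=
    fun a c e => (gW_integrable (gs_good n) ∅ (H3_integrable _ _ _)).const_mul _
  have e1 : ∀ x, gW v b (gs n) (deriv (gs n)) ∅ x * (∑ a, ∑ c, ∑ e, T a c e * gaussPDF3 d a c e x) =
      ∑ a, ∑ c, ∑ e, T a c e * (gW v b (gs n) (deriv (gs n)) ∅ x * (H3 (Pi.single a 1) (Pi.single c 1) (Pi.single e 1) x * gaussPDF d x)) := by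
    intro x
    simp only [Finset.mul_sum, gaussPDF3_eq]
    refine Finset.sum_congr rfl fun _ _ => Finset.sum_congr rfl fun _ _ => Finset.sum_congr rfl fun _ _ => ?_
    ring
  simp_rw [e1]
  rw [integral_finsetSum _ fun a _ => integrable_finsetSum _ fun c _ => integrable_finsetSum _ fun e _ => hi a c e]
  simp only [tc, LinearMap.coe_mk, AddHom.coe_mk]
  refine Finset.sum_congr rfl fun a _ => ?_
  rw [integral_finsetSum _ fun c _ => integrable_finsetSum _ fun e _ => hi a c e]
  refine Finset.sum_congr rfl fun c _ => ?_
  rw [integral_finsetSum _ fun e _ => hi a c e]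
  refine Finset.sum_congr rfl fun e _ => ?_
  rw [integral_const_mul]

lemma lin_indep (G : Geo v α β) (j k l : Fin d) (h1 : j ≠ k) (h2 : k ≠ l) (h3 : j ≠ l) :
    LinearIndependent ℝ ![v j, v k, v l] := by
  have hs := G.hs j k h1
  have hn := G.hn0 j k l h1 h2 h3
  have hdet : (Gm v ![j, k, l]).det ≠ 0 := by
    rw [det3 G.hu j k l hs]; positivity
  rw [Fintype.linearIndependent_iff]
  intro t ht
  have hc : cmb v ![j, k, l] t = 0 := by
    rw [← ht, cmb]
    simp [Fin.sum_univ_three]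
  have hz : Gm v ![j, k, l] *ᵥ t = 0 := by
    ext i
    rw [← cmb_dot, hc]; simp
  have := Matrix.eq_zero_of_mulVec_eq_zero hdet hz
  intro i; rw [this]; rfl

lemma final_bound (hd : 3 ≤ d) (G : Geo v α β) (T : Fin d → Fin d → Fin d → ℝ) (M : ℝ) (hM : 0 ≤ M)
    (m1 : ∀ j, |tc T (tp (v j) (v j) (v j))| ≤ M)
    (m2 : ∀ j k, j ≠ k → |tc T (tp (v j) (v j) (perpUnit (v j) (v k)))| ≤ M)
    (m3 : ∀ j k, j ≠ k → |tc T (tp (v j) (perpUnit (v j) (v k)) (v j))| ≤ M)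
    (m4 : ∀ j k, j ≠ k → |tc T (tp (v j) (perpUnit (v j) (v k)) (perpUnit (v j) (v k)))| ≤ M)
    (m5 : ∀ j k l, j ≠ k → k ≠ l → j ≠ l → |tc T (tp (v j) (perpUnit (v j) (v k)) (perpUnit2 (v j) (v k) (v l)))| ≤ M) :
    |∫ z in {x : Fin d → ℝ | ∀ j, x ⬝ᵥ v j ≤ b j}, ∑ a, ∑ c, ∑ e, T a c e * gaussPDF3 d a c e z| ≤
      (148896 * 12 ^ ((3:ℝ)/2)) * Real.log d ^ ((3 : ℝ) / 2) / (α * β) * M := by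
  have hF : Integrable (fun z => ∑ a, ∑ c, ∑ e, T a c e * gaussPDF3 d a c e z) := by
    simp only [gaussPDF3_eq]
    exact integrable_finsetSum _ fun a _ => integrable_finsetSum _ fun c _ => integrable_finsetSum _ fun e _ =>
      (H3_integrable _ _ _).const_mul _
  refine le_of_tendsto (int_lim (v := v) (b := b) _ hF).abs (Filter.Eventually.of_forall fun n => ?_)
  rw [tc_int]
  refine (tc_bound (gs_good n) G T M m1 m2 m3 m4 m5).trans ?_
  rw [mul_comm]
  exact mul_le_mul_of_nonneg_right (all_sum (gs_good n) G hd) hM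

end final

/-- third-derivative bound over convex polytopes.  For unit vectors the angle
between `v j` and `v k` is `arccos (v j ⬝ᵥ v k)`, and the angle between `v l` and the plane
spanned by `{v j, v k}` is the arccos of the norm of the orthogonal projection of `v l`
onto that plane, computed in the orthonormal basis `{v j, perpUnit (v j) (v k)}`. -/
theorem stmt8 :
    ∃ C : ℝ, 0 < C ∧
      ∀ d : ℕ, 3 ≤ d →
      ∀ v : Fin d → (Fin d → ℝ), Function.Injective v → (∀ j, ∑ i, v j i ^ 2 = 1) →
      ∀ b : Fin d → ℝ, ∀ α β : ℝ, 0 < α → 0 < β →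
        (∀ j k : Fin d, j ≠ k → α ≤ Real.arccos (v j ⬝ᵥ v k)) →
        (∀ j k l : Fin d, j ≠ k → k ≠ l → j ≠ l → v k ≠ -v j →
          β ≤ Real.arccos (Real.sqrt
            ((v j ⬝ᵥ v l) ^ 2 + (perpUnit (v j) (v k) ⬝ᵥ v l) ^ 2))) →
      ∀ T : Fin d → Fin d → Fin d → ℝ,
        letI V1 : Set (Fin d → ℝ) := {u | ∃ j, u = v j}
        letI V2 : Set (Fin d → ℝ) :=
          {u | ∃ j k : Fin d, j ≠ k ∧ v k ≠ -v j ∧ u = perpUnit (v j) (v k)}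
        letI V3 : Set (Fin d → ℝ) :=
          {u | ∃ j k l : Fin d, j ≠ k ∧ k ≠ l ∧ j ≠ l ∧
            LinearIndependent ℝ ![v j, v k, v l] ∧ u = perpUnit2 (v j) (v k) (v l)}
        |∫ z in {x : Fin d → ℝ | ∀ j, x ⬝ᵥ v j ≤ b j},
            ∑ a, ∑ c, ∑ e, T a c e * gaussPDF3 d a c e z| ≤
          C * Real.log d ^ ((3 : ℝ) / 2) / (α * β) *
            sSup {r : ℝ | ∃ u1 ∈ V1, ∃ u2 ∈ V1 ∪ V2, ∃ u3 ∈ V1 ∪ V2 ∪ V3,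
              r = |∑ a, ∑ c, ∑ e, T a c e * u1 a * u2 c * u3 e|} := by
  refine ⟨148896 * 12 ^ ((3:ℝ)/2), by positivity, ?_⟩
  intro d hd v _ hu b α β ha hb hα hβ T
  set V1 : Set (Fin d → ℝ) := {u | ∃ j, u = v j} with hV1
  set V2 : Set (Fin d → ℝ) :=
    {u | ∃ j k : Fin d, j ≠ k ∧ v k ≠ -v j ∧ u = perpUnit (v j) (v k)} with hV2
  set V3 : Set (Fin d → ℝ) :=
    {u | ∃ j k l : Fin d, j ≠ k ∧ k ≠ l ∧ j ≠ l ∧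
      LinearIndependent ℝ ![v j, v k, v l] ∧ u = perpUnit2 (v j) (v k) (v l)} with hV3
  have G : Geo v α β := geo_of hd hu α β ha hb hα hβ
  set S := {r : ℝ | ∃ u1 ∈ V1, ∃ u2 ∈ V1 ∪ V2, ∃ u3 ∈ V1 ∪ V2 ∪ V3,
              r = |∑ a, ∑ c, ∑ e, T a c e * u1 a * u2 c * u3 e|} with hS
  have f1 : V1.Finite := (Set.finite_range v).subset (by rintro u ⟨j, rfl⟩; exact ⟨j, rfl⟩)
  have f2 : V2.Finite := (Set.finite_range fun p : Fin d × Fin d => perpUnit (v p.1) (v p.2)).subset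
    (by rintro u ⟨j, k, _, _, rfl⟩; exact ⟨(j, k), rfl⟩)
  have f3 : V3.Finite := (Set.finite_range fun p : Fin d × Fin d × Fin d => perpUnit2 (v p.1) (v p.2.1) (v p.2.2)).subset
    (by rintro u ⟨j, k, l, _, _, _, _, rfl⟩; exact ⟨(j, k, l), rfl⟩)
  have fS : S.Finite := by
    refine ((f1.prod ((f1.union f2).prod ((f1.union f2).union f3))).image
      fun p => |∑ a, ∑ c, ∑ e, T a c e * p.1 a * p.2.1 c * p.2.2 e|).subset ?_
    rintro r ⟨u1, h1, u2, h2, u3, h3, rfl⟩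
    exact ⟨(u1, u2, u3), ⟨h1, h2, h3⟩, rfl⟩
  have hM0 : 0 ≤ sSup S := by
    apply Real.sSup_nonneg
    rintro r ⟨u1, h1, u2, h2, u3, h3, rfl⟩
    exact abs_nonneg _
  have hle : ∀ u1 ∈ V1, ∀ u2 ∈ V1 ∪ V2, ∀ u3 ∈ V1 ∪ V2 ∪ V3, |tc T (tp u1 u2 u3)| ≤ sSup S := by
    intro u1 h1 u2 h2 u3 h3
    refine le_csSup fS.bddAbove ⟨u1, h1, u2, h2, u3, h3, ?_⟩
    congr 1
    simp only [tc, LinearMap.coe_mk, AddHom.coe_mk, tp]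
    refine Finset.sum_congr rfl fun _ _ => Finset.sum_congr rfl fun _ _ => Finset.sum_congr rfl fun _ _ => ?_
    ring
  have i1 : ∀ j, v j ∈ V1 := fun j => ⟨j, rfl⟩
  have i2 : ∀ j k, j ≠ k → perpUnit (v j) (v k) ∈ V2 := fun j k h => ⟨j, k, h, G.hanti j k h, rfl⟩
  have i3 : ∀ j k l, j ≠ k → k ≠ l → j ≠ l → perpUnit2 (v j) (v k) (v l) ∈ V3 := fun j k l h1 h2 h3 =>
    ⟨j, k, l, h1, h2, h3, lin_indep G j k l h1 h2 h3, rfl⟩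
  exact final_bound hd G T (sSup S) hM0
    (fun j => hle _ (i1 j) _ (Or.inl (i1 j)) _ (Or.inl (Or.inl (i1 j))))
    (fun j k h => hle _ (i1 j) _ (Or.inl (i1 j)) _ (Or.inl (Or.inr (i2 j k h))))
    (fun j k h => hle _ (i1 j) _ (Or.inr (i2 j k h)) _ (Or.inl (Or.inl (i1 j))))
    (fun j k h => hle _ (i1 j) _ (Or.inr (i2 j k h)) _ (Or.inl (Or.inr (i2 j k h))))
    (fun j k l h1 h2 h3 => hle _ (i1 j) _ (Or.inr (i2 j k h1)) _ (Or.inr (i3 j k l h1 h2 h3)))
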